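/- Let S(X) denote the number of distinct biquadratic extensions K/ℚ (i.e., subfields K of a fixed algebraic closure of ℚ that are Galois over ℚ with Galois group isomorphic to (ℤ/2ℤ)²) whose discriminant Δ_K satisfies Δ_K ≤ X. Then S(X) = (23/960)·√X·(log X)²·∏_p (1 − 1/p)³(1 + 3/p) + O(√X·log X), where the product runs over all primes p. -/

import Mathlib

open scoped Classical
/-- The discriminant of a finite-dimensional intermediate field of `ℚ̄/ℚ`
(junk value `0` in the infinite-dimensional case). -/
noncomputable def biquadDiscr (K : IntermediateField ℚ (AlgebraicClosure ℚ)) : ℤ :=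
  if h : FiniteDimensional ℚ K then
    letI := h
    letI : NumberField K := ⟨⟩
    NumberField.discr K
  else 0

/-- `K` is a biquadratic extension of `ℚ`: a (finite) Galois extension with Galois group
isomorphic to `(ℤ/2ℤ)²`. -/
def IsBiquadratic (K : IntermediateField ℚ (AlgebraicClosure ℚ)) : Prop :=
  FiniteDimensional ℚ K ∧ IsGalois ℚ K ∧
    Nonempty ((K ≃ₐ[ℚ] K) ≃* Multiplicative (ZMod 2 × ZMod 2))

/-- The number of biquadratic extensions of `ℚ` (inside a fixed algebraic closure)
with discriminant at most `X`. -/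
noncomputable def biquadCount (X : ℝ) : ℕ :=
  Set.ncard {K : IntermediateField ℚ (AlgebraicClosure ℚ) |
    IsBiquadratic K ∧ (biquadDiscr K : ℝ) ≤ X}

open Finset in
/-- The summatory function of an arithmetic function. -/
noncomputable def summatory (f : ArithmeticFunction ℝ) (y : ℝ) : ℝ := ∑ n ∈ Ioc 0 ⌊y⌋₊, f n

lemma summatory_mul (f g : ArithmeticFunction ℝ) (y : ℝ) :
    summatory (f * g) y = ∑ n ∈ Finset.Ioc 0 ⌊y⌋₊, f n * summatory g (y / n) := by
  simp only [summatory, ArithmeticFunction.sum_Ioc_mul_eq_sum_sum, Nat.floor_div_natCast]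

/-- The constant function `1` as a real arithmetic function. -/
noncomputable def zetaR : ArithmeticFunction ℝ := (ArithmeticFunction.zeta : ArithmeticFunction ℕ)

lemma summatory_zetaR (y : ℝ) : summatory zetaR y = ⌊y⌋₊ := by
  have := ArithmeticFunction.sum_Ioc_zeta ⌊y⌋₊
  unfold summatory zetaR
  simp only [ArithmeticFunction.natCoe_apply]
  exact_mod_cast this

/-- Partial sums of the harmonic series, as a real function. -/
noncomputable def harm (N : ℕ) : ℝ := ∑ n ∈ Finset.Ioc 0 N, (1 : ℝ) / n

lemma harm_eq (N : ℕ) : harm N = (harmonic N : ℝ) := by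
  rw [harmonic_eq_sum_Icc, harm]
  push_cast
  simp only [one_div]
  rfl

lemma harm_succ (N : ℕ) : harm (N + 1) = harm N + 1 / ((N + 1 : ℕ) : ℝ) := by
  unfold harm
  rw [Finset.sum_Ioc_succ_top (Nat.zero_le N)]

lemma log_le_harm {y : ℝ} (hy : 1 ≤ y) : Real.log y ≤ harm ⌊y⌋₊ := by
  rw [harm_eq]; exact log_le_harmonic_floor y (by linarith)

lemma harm_le {y : ℝ} (hy : 1 ≤ y) : harm ⌊y⌋₊ ≤ 1 + Real.log y := by
  rw [harm_eq]; exact harmonic_floor_le_one_add_log y hy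

lemma sum_harm_div (N : ℕ) : ∑ n ∈ Finset.Ioc 0 N, harm n / n
    = (harm N ^ 2 + ∑ n ∈ Finset.Ioc 0 N, (1 : ℝ) / (n : ℝ) ^ 2) / 2 := by
  induction N with
  | zero => simp [harm]
  | succ N ih =>
    rw [Finset.sum_Ioc_succ_top (Nat.zero_le N), Finset.sum_Ioc_succ_top (Nat.zero_le N), ih,
      harm_succ]
    have : ((N + 1 : ℕ) : ℝ) ≠ 0 := by positivity
    field_simp
    ring

lemma one_le_div_of_mem {y : ℝ} {n : ℕ} (hn : n ∈ Finset.Ioc 0 ⌊y⌋₊) :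
    1 ≤ (n : ℝ) ∧ (n : ℝ) ≤ y := by
  rw [Finset.mem_Ioc] at hn
  refine ⟨by exact_mod_cast hn.1, ?_⟩
  exact (Nat.le_floor_iff' hn.1.ne').1 hn.2

lemma sum_log_div_bounds (N : ℕ) :
    harm N ^ 2 / 2 - harm N ≤ ∑ n ∈ Finset.Ioc 0 N, Real.log n / n ∧
    ∑ n ∈ Finset.Ioc 0 N, Real.log n / n ≤ harm N ^ 2 / 2 + harm N := by
  have h := sum_harm_div N
  have h2 : ∑ n ∈ Finset.Ioc 0 N, (1 : ℝ) / (n : ℝ) ^ 2 ≤ harm N := by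
    refine Finset.sum_le_sum fun n hn => ?_
    rw [Finset.mem_Ioc] at hn
    have : (1 : ℝ) ≤ n := by exact_mod_cast hn.1
    exact one_div_le_one_div_of_le (by linarith) (by nlinarith)
  have h3 : 0 ≤ ∑ n ∈ Finset.Ioc 0 N, (1 : ℝ) / (n : ℝ) ^ 2 :=
    Finset.sum_nonneg fun n _ => by positivity
  have h4 : ∑ n ∈ Finset.Ioc 0 N, Real.log n / n ≤ ∑ n ∈ Finset.Ioc 0 N, harm n / n := by
    refine Finset.sum_le_sum fun n hn => ?_
    rw [Finset.mem_Ioc] at hn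
    have h1 : (1 : ℝ) ≤ n := by exact_mod_cast hn.1
    have := log_le_harm h1
    rw [Nat.floor_natCast] at this
    gcongr
  have h5 : ∑ n ∈ Finset.Ioc 0 N, harm n / n ≤ harm N + ∑ n ∈ Finset.Ioc 0 N, Real.log n / n := by
    rw [harm, ← Finset.sum_add_distrib]
    refine Finset.sum_le_sum fun n hn => ?_
    rw [Finset.mem_Ioc] at hn
    have h1 : (1 : ℝ) ≤ n := by exact_mod_cast hn.1
    have := harm_le h1
    rw [Nat.floor_natCast] at this
    rw [← add_div]
    gcongr
  constructor <;> linarith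

lemma summatory_zetaR_sq {y : ℝ} (hy : 1 ≤ y) :
    |summatory (zetaR * zetaR) y - y * Real.log y| ≤ 2 * y := by
  have h0 : summatory (zetaR * zetaR) y = ∑ n ∈ Finset.Ioc 0 ⌊y⌋₊, (⌊y / n⌋₊ : ℝ) := by
    rw [summatory_mul]
    refine Finset.sum_congr rfl fun n hn => ?_
    rw [Finset.mem_Ioc] at hn
    rw [summatory_zetaR]
    simp [zetaR, ArithmeticFunction.natCoe_apply, ArithmeticFunction.zeta_apply, hn.1.ne']
  have h1 : summatory (zetaR * zetaR) y ≤ y * harm ⌊y⌋₊ := by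
    rw [h0, harm, Finset.mul_sum]
    refine Finset.sum_le_sum fun n hn => ?_
    rw [mul_one_div]
    exact Nat.floor_le (by positivity)
  have h2 : y * harm ⌊y⌋₊ ≤ summatory (zetaR * zetaR) y + ⌊y⌋₊ := by
    have : (⌊y⌋₊ : ℝ) = ∑ n ∈ Finset.Ioc 0 ⌊y⌋₊, (1 : ℝ) := by simp
    rw [this, h0, harm, Finset.mul_sum, ← Finset.sum_add_distrib]
    refine Finset.sum_le_sum fun n hn => ?_
    rw [mul_one_div]
    exact (Nat.lt_floor_add_one _).le
  have h3 : (⌊y⌋₊ : ℝ) ≤ y := Nat.floor_le (by linarith)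
  have h4 := log_le_harm hy
  have h5 := harm_le hy
  rw [abs_le]
  constructor <;> nlinarith

/-- The three-fold divisor function. -/
noncomputable def divThree : ArithmeticFunction ℝ := zetaR * (zetaR * zetaR)

lemma summatory_divThree {y : ℝ} (hy : 1 ≤ y) :
    |summatory divThree y - y * Real.log y ^ 2 / 2| ≤ 4 * y * (1 + Real.log y) := by
  set l := Real.log y with hl
  have hl0 : 0 ≤ l := Real.log_nonneg hy
  set H := harm ⌊y⌋₊ with hH
  have h4 : l ≤ H := log_le_harm hy
  have h5 : H ≤ 1 + l := harm_le hy
  obtain ⟨h6, h7⟩ := sum_log_div_bounds ⌊y⌋₊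
  rw [← hH] at h6 h7
  set S := ∑ n ∈ Finset.Ioc 0 ⌊y⌋₊, Real.log n / n with hS
  have h0 : |summatory divThree y - y * (l * H - S)| ≤ 2 * y * H := by
    have e1 : y * (l * H - S) =
        ∑ n ∈ Finset.Ioc 0 ⌊y⌋₊, (y / n) * Real.log (y / n) := by
      rw [hH, hS, harm, Finset.mul_sum, ← Finset.sum_sub_distrib, Finset.mul_sum]
      refine Finset.sum_congr rfl fun n hn => ?_
      obtain ⟨hn1, hn2⟩ := one_le_div_of_mem hn
      rw [Real.log_div (by linarith) (by linarith)]
      ring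
    have e2 : summatory divThree y =
        ∑ n ∈ Finset.Ioc 0 ⌊y⌋₊, summatory (zetaR * zetaR) (y / n) := by
      rw [divThree, summatory_mul]
      refine Finset.sum_congr rfl fun n hn => ?_
      rw [Finset.mem_Ioc] at hn
      simp [zetaR, ArithmeticFunction.natCoe_apply, ArithmeticFunction.zeta_apply, hn.1.ne']
    rw [e1, e2, ← Finset.sum_sub_distrib, hH, harm, Finset.mul_sum]
    refine (Finset.abs_sum_le_sum_abs _ _).trans (Finset.sum_le_sum fun n hn => ?_)
    obtain ⟨hn1, hn2⟩ := one_le_div_of_mem hn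
    have := summatory_zetaR_sq (y := y / n) (by rw [le_div_iff₀ (by linarith)]; linarith)
    calc _ ≤ _ := this
      _ = _ := by ring
  have h8 : |y * (l * H - S) - y * l ^ 2 / 2| ≤ y * (3 / 2 + l) := by
    have : |(l * H - S) - l ^ 2 / 2| ≤ 3 / 2 + l := by
      rw [abs_le]; constructor <;> nlinarith
    calc _ = |y * ((l * H - S) - l ^ 2 / 2)| := by congr 1; ring
      _ = y * |(l * H - S) - l ^ 2 / 2| := by rw [abs_mul, abs_of_nonneg (by linarith)]
      _ ≤ _ := by gcongr
  rw [abs_le] at *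
  constructor <;> nlinarith

lemma four_add_log_le {n : ℕ} (hn : 1 ≤ n) :
    (4 + Real.log n) / n ≤ 8 * (n : ℝ) ^ (-(3 / 4) : ℝ) := by
  have h1 : (1 : ℝ) ≤ n := by exact_mod_cast hn
  have h2 := Real.log_le_rpow_div (x := n) (ε := 1 / 4) (by linarith) (by norm_num)
  have h3 : (1 : ℝ) ≤ (n : ℝ) ^ (1 / 4 : ℝ) := Real.one_le_rpow h1 (by norm_num)
  have h4 : (n : ℝ) ^ (-(3 / 4) : ℝ) = (n : ℝ) ^ (1 / 4 : ℝ) / n := by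
    rw [eq_div_iff (by linarith), ← Real.rpow_add_one (by linarith)]
    norm_num
  rw [h4, mul_div_assoc']
  gcongr
  linarith

lemma summatory_mul_divThree {g : ArithmeticFunction ℝ}
    (hg : Summable fun n : ℕ => |g n| * (n : ℝ) ^ (-(3 / 4) : ℝ)) :
    ∃ B : ℝ, ∀ y : ℝ, 1 ≤ y →
      |summatory (g * divThree) y - (∑' n, g n / n) / 2 * y * Real.log y ^ 2|
        ≤ B * y * (1 + Real.log y) := by
  have hB : Summable fun n : ℕ => |g n| * ((4 + Real.log n) / n) := by
    refine Summable.of_nonneg_of_le (fun n => ?_) (fun n => ?_) (hg.mul_left 8)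
    · have := Real.log_natCast_nonneg n
      positivity
    · rcases Nat.eq_zero_or_pos n with rfl | hn
      · simp
      · calc _ ≤ |g n| * (8 * (n : ℝ) ^ (-(3 / 4) : ℝ)) := by
              gcongr; exact four_add_log_le hn
          _ = _ := by ring
  have hc : Summable fun n : ℕ => g n / n := by
    refine Summable.of_norm_bounded hB fun n => ?_
    have := Real.log_natCast_nonneg n
    rw [norm_div, Real.norm_eq_abs, Real.norm_natCast, div_eq_mul_one_div]
    gcongr
    linarith
  refine ⟨∑' n, |g n| * ((4 + Real.log n) / n), fun y hy => ?_⟩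
  set l := Real.log y with hl
  have hl0 : 0 ≤ l := Real.log_nonneg hy
  let s := Finset.Ioc 0 ⌊y⌋₊
  let F : ℕ → ℝ := fun n => if n ∈ s then g n * summatory divThree (y / n) else 0
  have hF : ∀ n ∉ s, F n = 0 := fun n hn => by simp [F, hn]
  have hFs : Summable F := summable_of_ne_finset_zero hF
  have e1 : summatory (g * divThree) y = ∑' n, F n := by
    rw [summatory_mul, tsum_eq_sum hF]
    refine Finset.sum_congr rfl fun n hn => ?_
    simp only [F, s, hn, if_true]
  have hc' : Summable fun n : ℕ => g n / n * (y * l ^ 2 / 2) := hc.mul_right _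
  have e2 : (∑' n, g n / n) / 2 * y * l ^ 2 = ∑' n : ℕ, g n / n * (y * l ^ 2 / 2) := by
    rw [tsum_mul_right]; ring
  rw [e1, e2, ← hFs.tsum_sub hc', mul_assoc, ← tsum_mul_right]
  refine (norm_tsum_le_tsum_norm (hFs.sub hc').norm).trans ?_
  refine (hFs.sub hc').norm.tsum_le_tsum (fun n => ?_) (hB.mul_right _)
  rw [Real.norm_eq_abs]
  rcases Nat.eq_zero_or_pos n with rfl | hn0
  · simp [F]
  have hn1 : (1 : ℝ) ≤ n := by exact_mod_cast hn0
  have hlog : 0 ≤ Real.log n := Real.log_nonneg hn1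
  by_cases hn : n ∈ s
  · obtain ⟨-, hny⟩ := one_le_div_of_mem hn
    have hyn : 1 ≤ y / n := by rw [le_div_iff₀ (by linarith)]; linarith
    have hd := summatory_divThree hyn
    rw [Real.log_div (by linarith) (by linarith), ← hl] at hd
    have hln : Real.log n ≤ l := Real.log_le_log (by linarith) hny
    have h3 : |summatory divThree (y / n) - y / n * l ^ 2 / 2| ≤
        (y / n) * ((4 + Real.log n) * (1 + l)) := by
      have h4 : |y / n * (l - Real.log n) ^ 2 / 2 - y / n * l ^ 2 / 2| ≤
          (y / n) * (Real.log n * l) := by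
        have e : y / n * (l - Real.log n) ^ 2 / 2 - y / n * l ^ 2 / 2
          = (y / n) * (((l - Real.log n) ^ 2 - l ^ 2) / 2) := by ring
        rw [e, abs_mul, abs_of_nonneg (by linarith)]
        gcongr
        rw [abs_le]; constructor <;> nlinarith
      have h5 : 4 * (y / n) * (1 + (l - Real.log n)) + (y / n) * (Real.log n * l)
          ≤ (y / n) * ((4 + Real.log n) * (1 + l)) := by
        have : 4 * (1 + (l - Real.log n)) + (Real.log n * l) ≤ ((4 + Real.log n) * (1 + l)) := by
          nlinarith
        nlinarith
      refine le_trans ?_ h5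
      calc _ = |(summatory divThree (y / n) - y / n * (l - Real.log n) ^ 2 / 2) +
          (y / n * (l - Real.log n) ^ 2 / 2 - y / n * l ^ 2 / 2)| := by congr 1; ring
        _ ≤ _ := (abs_add_le _ _).trans (add_le_add hd h4)
    simp only [F, hn, if_true]
    calc |g n * summatory divThree (y / n) - g n / n * (y * l ^ 2 / 2)|
        = |g n| * |summatory divThree (y / n) - y / n * l ^ 2 / 2| := by
          rw [← abs_mul]; congr 1; ring
      _ ≤ |g n| * ((y / n) * ((4 + Real.log n) * (1 + l))) := by gcongr
      _ = _ := by ring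
  · have hny : y ≤ n := by
      by_contra! h
      exact hn (Finset.mem_Ioc.2 ⟨hn0, Nat.le_floor h.le⟩)
    have hln : l ≤ Real.log n := Real.log_le_log (by linarith) hny
    simp only [F, hn, if_false, zero_sub, abs_neg]
    calc |g n / n * (y * l ^ 2 / 2)| = |g n| * ((y / n) * (l ^ 2 / 2)) := by
          rw [abs_mul, abs_div, Nat.abs_cast, abs_of_nonneg (show 0 ≤ y * l ^ 2 / 2 by positivity)]
          ring
      _ ≤ |g n| * ((y / n) * ((4 + Real.log n) * (1 + l))) := by
          gcongr
          nlinarith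
      _ = _ := by ring

/-- `3 ^ ω n` on odd squarefree `n`, and zero elsewhere. -/
noncomputable def oddTriple : ArithmeticFunction ℝ where
  toFun n := if Odd n ∧ Squarefree n then 3 ^ ArithmeticFunction.cardDistinctFactors n else 0
  map_zero' := by simp

lemma oddTriple_apply (n : ℕ) : oddTriple n =
    if Odd n ∧ Squarefree n then 3 ^ ArithmeticFunction.cardDistinctFactors n else 0 := rfl

lemma oddTriple_isMultiplicative : oddTriple.IsMultiplicative := by
  refine ⟨by simp [oddTriple_apply], fun {m n} h => ?_⟩
  simp only [oddTriple_apply, Nat.odd_mul, Nat.squarefree_mul_iff,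
    ArithmeticFunction.cardDistinctFactors_mul h, pow_add]
  have h' : m.Coprime n := h
  by_cases h1 : Odd m ∧ Squarefree m
  · by_cases h2 : Odd n ∧ Squarefree n
    · simp [h1, h2, h']
    · rw [if_neg h2, mul_zero, if_neg (by tauto)]
  · rw [if_neg h1, zero_mul, if_neg (by tauto)]

/-- The Möbius function with real values. -/
noncomputable def moebiusR : ArithmeticFunction ℝ :=
  (ArithmeticFunction.moebius : ArithmeticFunction ℤ)

lemma moebiusR_mul_zetaR : moebiusR * zetaR = 1 := by
  exact ArithmeticFunction.coe_moebius_mul_coe_zeta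

lemma moebiusR_isMultiplicative : moebiusR.IsMultiplicative :=
  ArithmeticFunction.isMultiplicative_moebius.intCast

/-- The convolution quotient of `oddTriple` by the three-fold divisor function. -/
noncomputable def tripleQuot : ArithmeticFunction ℝ :=
  moebiusR * (moebiusR * (moebiusR * oddTriple))

lemma tripleQuot_mul_divThree : tripleQuot * divThree = oddTriple := by
  calc _ = (moebiusR * zetaR) * ((moebiusR * zetaR) * ((moebiusR * zetaR) * oddTriple)) := by
        rw [tripleQuot, divThree]; ring
    _ = _ := by simp [moebiusR_mul_zetaR]

lemma tripleQuot_isMultiplicative : tripleQuot.IsMultiplicative :=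
  moebiusR_isMultiplicative.mul <| moebiusR_isMultiplicative.mul <|
    moebiusR_isMultiplicative.mul oddTriple_isMultiplicative

lemma moebiusR_mul_prime_pow (h : ArithmeticFunction ℝ) {p : ℕ} (hp : p.Prime) (k : ℕ) :
    (moebiusR * h) (p ^ (k + 1)) = h (p ^ (k + 1)) - h (p ^ k) := by
  rw [ArithmeticFunction.mul_apply, Nat.sum_divisorsAntidiagonal (fun a b => moebiusR a * h b),
    Nat.sum_divisors_prime_pow hp, Finset.sum_range_succ', Finset.sum_range_succ']
  have h0 : ∀ i ∈ Finset.range k, moebiusR (p ^ (i + 1 + 1)) * h (p ^ (k + 1) / p ^ (i + 1 + 1))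
      = 0 := by
    intro i _
    rw [moebiusR, ArithmeticFunction.intCoe_apply,
      ArithmeticFunction.moebius_apply_prime_pow hp (by lia)]
    simp
  rw [Finset.sum_eq_zero h0]
  have h1 : moebiusR (p ^ (0 + 1)) = -1 := by
    rw [moebiusR, ArithmeticFunction.intCoe_apply,
      ArithmeticFunction.moebius_apply_prime_pow hp (by lia)]
    simp
  have h2 : p ^ (k + 1) / p ^ (0 + 1) = p ^ k := by
    rw [Nat.pow_div (by lia) hp.pos]; rfl
  rw [h1, h2]
  simp [moebiusR]
  ring

lemma moebiusR_mul_one (h : ArithmeticFunction ℝ) : (moebiusR * h) 1 = h 1 := by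
  simp [moebiusR, ArithmeticFunction.mul_apply]

lemma oddTriple_prime {p : ℕ} (hp : p.Prime) (hp2 : p ≠ 2) : oddTriple p = 3 := by
  rw [oddTriple_apply, if_pos ⟨hp.odd_of_ne_two hp2, hp.squarefree⟩,
    ArithmeticFunction.cardDistinctFactors_apply_prime hp, pow_one]

lemma oddTriple_prime_pow {p : ℕ} (hp : p.Prime) {k : ℕ} (hk : 2 ≤ k) :
    oddTriple (p ^ k) = 0 := by
  rw [oddTriple_apply, if_neg]
  rintro ⟨-, h⟩
  rw [Nat.squarefree_pow_iff hp.ne_one (by lia)] at h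
  lia

lemma oddTriple_two_pow {k : ℕ} (hk : k ≠ 0) : oddTriple (2 ^ k) = 0 := by
  rw [oddTriple_apply, if_neg]
  rintro ⟨h, -⟩
  rw [← Nat.not_even_iff_odd] at h
  exact h (by simp [Nat.even_pow, hk])

lemma tripleQuot_prime_pow {p : ℕ} (hp : p.Prime) (hp2 : p ≠ 2) :
    tripleQuot (p ^ 0) = 1 ∧ tripleQuot (p ^ 1) = 0 ∧ tripleQuot (p ^ 2) = -6 ∧
      tripleQuot (p ^ 3) = 8 ∧ tripleQuot (p ^ 4) = -3 ∧ ∀ k, tripleQuot (p ^ (k + 5)) = 0 := by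
  have h0 : oddTriple (p ^ 0) = 1 := by simp [oddTriple_isMultiplicative.1]
  have h1 : oddTriple (p ^ 1) = 3 := by rw [pow_one]; exact oddTriple_prime hp hp2
  have h2 : ∀ k, oddTriple (p ^ (k + 2)) = 0 := fun k => oddTriple_prime_pow hp (by lia)
  have h20 := h2 0
  have h21 := h2 1
  have h22 := h2 2
  have A := fun h => moebiusR_mul_prime_pow h hp
  have A0 := fun h => A h 0
  have A1 := fun h => A h 1
  have A2 := fun h => A h 2
  have A3 := fun h => A h 3
  have B : ∀ h, (moebiusR * h) (p ^ 0) = h (p ^ 0) := fun h => by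
    rw [pow_zero, moebiusR_mul_one]
  norm_num only at A0 A1 A2 A3 h20 h21 h22
  unfold tripleQuot
  refine ⟨?_, ?_, ?_, ?_, ?_, fun k => ?_⟩
  · simp only [B, h0]
  · simp only [A0, B, h0, h1]; norm_num
  · simp only [A0, A1, B, h0, h1, h20]; norm_num
  · simp only [A0, A1, A2, h0, h1, h20, h21]; norm_num
  · simp only [A1, A2, A3, h1, h20, h21, h22]; norm_num
  · simp only [A, h2]; norm_num

lemma tripleQuot_two_pow :
    tripleQuot (2 ^ 0) = 1 ∧ tripleQuot (2 ^ 1) = -3 ∧ tripleQuot (2 ^ 2) = 3 ∧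
      tripleQuot (2 ^ 3) = -1 ∧ tripleQuot (2 ^ 4) = 0 ∧ ∀ k, tripleQuot (2 ^ (k + 5)) = 0 := by
  have h0 : oddTriple (2 ^ 0) = 1 := by simp [oddTriple_isMultiplicative.1]
  have h2 : ∀ k, oddTriple (2 ^ (k + 1)) = 0 := fun k => oddTriple_two_pow (by lia)
  have h20 := h2 0
  have h21 := h2 1
  have h22 := h2 2
  have h23 := h2 3
  have A := fun h => moebiusR_mul_prime_pow h Nat.prime_two
  have A0 := fun h => A h 0
  have A1 := fun h => A h 1
  have A2 := fun h => A h 2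
  have A3 := fun h => A h 3
  have B : ∀ h, (moebiusR * h) (2 ^ 0) = h (2 ^ 0) := fun h => by
    rw [pow_zero, moebiusR_mul_one]
  rw [zero_add] at A0 h20
  rw [show 1 + 1 = 2 from rfl] at h21
  rw [show 2 + 1 = 3 from rfl] at h22
  rw [show 3 + 1 = 4 from rfl] at h23
  simp only [show 1 + 1 = 2 from rfl, show 2 + 1 = 3 from rfl, show 3 + 1 = 4 from rfl] at A1 A2 A3
  unfold tripleQuot
  refine ⟨?_, ?_, ?_, ?_, ?_, fun k => ?_⟩
  · simp only [B, h0]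
  · simp only [A0, B, h0, h20]; norm_num
  · simp only [A0, A1, B, h0, h20, h21]; norm_num
  · simp only [A0, A1, A2, h0, h20, h21, h22]; norm_num
  · simp only [A1, A2, A3, h20, h21, h22, h23]; norm_num
  · simp only [A, h2]; norm_num

lemma hasSum_five {u : ℕ → ℝ} (hu : ∀ k, u (k + 5) = 0) :
    HasSum u (u 0 + u 1 + u 2 + u 3 + u 4) := by
  have : HasSum u (∑ b ∈ Finset.range 5, u b) := hasSum_sum_of_ne_finset_zero fun b hb => by
    rw [Finset.mem_range, not_lt] at hb
    obtain ⟨k, rfl⟩ := Nat.exists_eq_add_of_le' hb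
    exact hu k
  simpa [Finset.sum_range_succ] using this

lemma tripleQuot_prime_pow_add_five {p : ℕ} (hp : p.Prime) (k : ℕ) :
    tripleQuot (p ^ (k + 5)) = 0 := by
  by_cases hp2 : p = 2
  · subst hp2; exact tripleQuot_two_pow.2.2.2.2.2 k
  · exact (tripleQuot_prime_pow hp hp2).2.2.2.2.2 k

/-- The weighted absolute value of `tripleQuot`, used to prove convergence. -/
noncomputable def quotWeight (n : ℕ) : ℝ := |tripleQuot n| * (n : ℝ) ^ (-(3 / 4) : ℝ)

lemma quotWeight_nonneg (n : ℕ) : 0 ≤ quotWeight n := by unfold quotWeight; positivity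

lemma quotWeight_prime_pow_zero {p : ℕ} (hp : p.Prime) (k : ℕ) : quotWeight (p ^ (k + 5)) = 0 := by
  simp [quotWeight, tripleQuot_prime_pow_add_five hp]

lemma quotWeight_prime_pow_tsum {p : ℕ} (hp : p.Prime) :
    ∑' k, quotWeight (p ^ k) ≤ Real.exp (40 * (p : ℝ) ^ (-(3 / 2) : ℝ)) := by
  rw [(hasSum_five (quotWeight_prime_pow_zero hp)).tsum_eq]
  refine le_trans ?_ (Real.add_one_le_exp _)
  set x : ℝ := (p : ℝ) ^ (-(3 / 4) : ℝ) with hx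
  have hp0 : (0 : ℝ) ≤ p := by positivity
  have hpx : ∀ k : ℕ, ((p ^ k : ℕ) : ℝ) ^ (-(3 / 4) : ℝ) = x ^ k := by
    intro k
    rw [Nat.cast_pow, ← Real.rpow_natCast, ← Real.rpow_mul hp0, mul_comm, Real.rpow_mul hp0,
      Real.rpow_natCast]
  have hx2 : (p : ℝ) ^ (-(3 / 2) : ℝ) = x ^ 2 := by
    rw [hx, ← Real.rpow_natCast, ← Real.rpow_mul hp0]; norm_num
  have hx0 : 0 ≤ x := by positivity
  have hx1 : x ≤ 1 := Real.rpow_le_one_of_one_le_of_nonpos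
    (by exact_mod_cast hp.one_lt.le) (by norm_num)
  simp only [quotWeight, hpx, hx2]
  by_cases hp2 : p = 2
  · subst hp2
    obtain ⟨h0, h1, h2, h3, h4, -⟩ := tripleQuot_two_pow
    rw [h0, h1, h2, h3, h4]
    have hx3 : (1 : ℝ) / 4 ≤ x ^ 2 := by
      rw [← hx2]
      calc (1 : ℝ) / 4 = (2 : ℝ) ^ (-2 : ℝ) := by
            rw [Real.rpow_neg (by norm_num)]; norm_num
        _ ≤ _ := by
          push_cast
          exact Real.rpow_le_rpow_of_exponent_le (by norm_num) (by norm_num)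
    norm_num
    nlinarith [mul_nonneg hx0 hx0]
  · obtain ⟨h0, h1, h2, h3, h4, -⟩ := tripleQuot_prime_pow hp hp2
    rw [h0, h1, h2, h3, h4]
    norm_num
    nlinarith [mul_nonneg hx0 hx0, mul_nonneg (mul_nonneg hx0 hx0) hx0,
      mul_nonneg (mul_nonneg hx0 hx0) (sub_nonneg.2 hx1)]

lemma quotWeight_summable : Summable quotWeight := by
  have hS : Summable fun n : ℕ => (n : ℝ) ^ (-(3 / 2) : ℝ) :=
    Real.summable_nat_rpow.2 (by norm_num)
  refine summable_of_sum_le (c := Real.exp (40 * ∑' n : ℕ, (n : ℝ) ^ (-(3 / 2) : ℝ)))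
    quotWeight_nonneg fun u => ?_
  have h1 : quotWeight 1 = 1 := by simp [quotWeight, tripleQuot_isMultiplicative.1]
  have hmul : ∀ {m n : ℕ}, m.Coprime n → quotWeight (m * n) = quotWeight m * quotWeight n := by
    intro m n h
    simp only [quotWeight, tripleQuot_isMultiplicative.map_mul_of_coprime h, abs_mul, Nat.cast_mul]
    rw [Real.mul_rpow (by positivity) (by positivity)]
    ring
  have hsum : ∀ {p : ℕ}, p.Prime → Summable fun n : ℕ => ‖quotWeight (p ^ n)‖ := fun {p} hp =>
    (hasSum_five (quotWeight_prime_pow_zero hp)).summable.norm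
  obtain ⟨N, hN⟩ : ∃ N, ∀ n ∈ u, n < N :=
    ⟨u.sup id + 1, fun n hn => Nat.lt_succ_of_le (Finset.le_sup (f := id) hn)⟩
  obtain ⟨-, hs⟩ := EulerProduct.summable_and_hasSum_smoothNumbers_prod_primesBelow_tsum
    h1 hmul hsum N
  have hz : quotWeight 0 = 0 := by simp [quotWeight]
  calc ∑ n ∈ u, quotWeight n = ∑ n ∈ u.filter (· ≠ 0), quotWeight n := by
        rw [Finset.sum_filter]
        refine Finset.sum_congr rfl fun n _ => ?_
        by_cases hn : n = 0 <;> simp [hn, hz]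
    _ = ∑ n ∈ (u.filter (· ≠ 0)).subtype (· ∈ N.smoothNumbers), quotWeight n := by
        rw [Finset.sum_subtype_of_mem]
        intro n hn
        rw [Finset.mem_filter] at hn
        exact Nat.mem_smoothNumbers_of_lt (Nat.pos_of_ne_zero hn.2) (hN n hn.1)
    _ ≤ ∏ p ∈ N.primesBelow, ∑' k, quotWeight (p ^ k) :=
        sum_le_hasSum _ (fun n _ => quotWeight_nonneg n) hs
    _ ≤ ∏ p ∈ N.primesBelow, Real.exp (40 * (p : ℝ) ^ (-(3 / 2) : ℝ)) := by
        refine Finset.prod_le_prod (fun p _ => tsum_nonneg fun k => quotWeight_nonneg _)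
          fun p hp => quotWeight_prime_pow_tsum (Nat.prime_of_mem_primesBelow hp)
    _ ≤ _ := by
        rw [← Real.exp_sum, ← Finset.mul_sum]
        gcongr
        exact hS.sum_le_tsum _ fun n _ => by positivity

lemma quot_euler_factor {p : ℕ} (hp : p.Prime) :
    (∑' k, tripleQuot (p ^ k) / ((p ^ k : ℕ) : ℝ)) * (if p = 2 then 5 / 2 else 1)
      = (1 - 1 / (p : ℝ)) ^ 3 * (1 + 3 / (p : ℝ)) := by
  rw [(hasSum_five (u := fun k => tripleQuot (p ^ k) / ((p ^ k : ℕ) : ℝ))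
    (fun k => by simp [tripleQuot_prime_pow_add_five hp])).tsum_eq]
  have hp0 : (p : ℝ) ≠ 0 := by exact_mod_cast hp.ne_zero
  by_cases hp2 : p = 2
  · subst hp2
    obtain ⟨h0, h1, h2, h3, h4, -⟩ := tripleQuot_two_pow
    rw [h0, h1, h2, h3, h4]
    norm_num
  · obtain ⟨h0, h1, h2, h3, h4, -⟩ := tripleQuot_prime_pow hp hp2
    rw [h0, h1, h2, h3, h4, if_neg hp2]
    push_cast
    field_simp
    ring

lemma quot_euler_product :
    ∏' p : Nat.Primes, (1 - 1 / (p : ℝ)) ^ 3 * (1 + 3 / (p : ℝ))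
      = 5 / 2 * ∑' n, tripleQuot n / n := by
  have hs : Summable fun n : ℕ => ‖tripleQuot n / (n : ℝ)‖ := by
    refine quotWeight_summable.of_nonneg_of_le (fun n => norm_nonneg _) fun n => ?_
    rcases Nat.eq_zero_or_pos n with rfl | hn
    · simp [quotWeight]
    have h1 : (1 : ℝ) ≤ n := by exact_mod_cast hn
    rw [norm_div, Real.norm_eq_abs, Real.norm_natCast, div_eq_mul_inv, quotWeight,
      ← Real.rpow_neg_one]
    gcongr ?_ * ?_
    exact Real.rpow_le_rpow_of_exponent_le h1 (by norm_num)
  have H := EulerProduct.eulerProduct_hasProd (f := fun n : ℕ => tripleQuot n / (n : ℝ))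
    (by simp [tripleQuot_isMultiplicative.1])
    (fun {m n} h => by
      simp only [tripleQuot_isMultiplicative.map_mul_of_coprime h, Nat.cast_mul]
      rw [mul_div_mul_comm])
    hs (by simp)
  have H2 : HasProd (fun p : Nat.Primes => if (p : ℕ) = 2 then (5 / 2 : ℝ) else 1) (5 / 2) := by
    have := hasProd_single (f := fun p : Nat.Primes => if (p : ℕ) = 2 then (5 / 2 : ℝ) else 1)
      ⟨2, Nat.prime_two⟩ (fun p hp => by
        rw [if_neg]
        intro h
        exact hp (Subtype.ext h))
    simpa using this
  have H3 := H.mul H2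
  rw [mul_comm, ← H3.tprod_eq]
  exact tprod_congr fun p => (quot_euler_factor p.2).symm

/-- The asymptotic formula for the summatory function of `oddTriple`. -/
lemma summatory_oddTriple : ∃ B : ℝ, ∀ y : ℝ, 1 ≤ y →
    |summatory oddTriple y -
      (∏' p : Nat.Primes, (1 - 1 / (p : ℝ)) ^ 3 * (1 + 3 / (p : ℝ))) / 5 * y * Real.log y ^ 2|
        ≤ B * y * (1 + Real.log y) := by
  obtain ⟨B, hB⟩ := summatory_mul_divThree (g := tripleQuot) quotWeight_summable
  refine ⟨B, fun y hy => ?_⟩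
  have := hB y hy
  rw [tripleQuot_mul_divThree] at this
  rw [quot_euler_product]
  convert this using 5
  ring

/-- `s₁, s₂, s₃` are square roots of the squarefree integers `bc, ac, ab`, and together with `1`
they span `K`, which has all three automorphisms changing two of the signs. -/
structure BiquadGen (K : Type*) [Field K] [Algebra ℚ K] (s₁ s₂ s₃ : K) (a b c : ℤ) : Prop where
  sf₁ : Squarefree (b * c)
  sf₂ : Squarefree (a * c)
  sf₃ : Squarefree (a * b)
  sq₁ : s₁ ^ 2 = b * c
  sq₂ : s₂ ^ 2 = a * c
  sq₃ : s₃ ^ 2 = a * b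
  mul₁₂ : s₁ * s₂ = c * s₃
  mul₂₃ : s₂ * s₃ = a * s₁
  mul₁₃ : s₁ * s₃ = b * s₂
  aut₁ : ∃ σ : K ≃ₐ[ℚ] K, σ s₁ = s₁ ∧ σ s₂ = -s₂ ∧ σ s₃ = -s₃
  aut₂ : ∃ σ : K ≃ₐ[ℚ] K, σ s₁ = -s₁ ∧ σ s₂ = s₂ ∧ σ s₃ = -s₃
  aut₃ : ∃ σ : K ≃ₐ[ℚ] K, σ s₁ = -s₁ ∧ σ s₂ = -s₂ ∧ σ s₃ = s₃
  span : ∀ x : K, ∃ α β γ δ : ℚ, x = α + β * s₁ + γ * s₂ + δ * s₃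

namespace BiquadGen

section Field

variable {K : Type*} [Field K] [Algebra ℚ K] {s₁ s₂ s₃ : K} {a b c : ℤ}

lemma swap (h : BiquadGen K s₁ s₂ s₃ a b c) : BiquadGen K s₂ s₁ s₃ b a c where
  sf₁ := h.sf₂
  sf₂ := h.sf₁
  sf₃ := by rw [mul_comm]; exact h.sf₃
  sq₁ := h.sq₂
  sq₂ := h.sq₁
  sq₃ := by rw [h.sq₃, mul_comm]
  mul₁₂ := by rw [mul_comm, h.mul₁₂]
  mul₂₃ := h.mul₁₃
  mul₁₃ := h.mul₂₃
  aut₁ := let ⟨σ, h1, h2, h3⟩ := h.aut₂; ⟨σ, h2, h1, h3⟩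
  aut₂ := let ⟨σ, h1, h2, h3⟩ := h.aut₁; ⟨σ, h2, h1, h3⟩
  aut₃ := let ⟨σ, h1, h2, h3⟩ := h.aut₃; ⟨σ, h2, h1, h3⟩
  span := fun x => by
    obtain ⟨α, β, γ, δ, h⟩ := h.span x
    exact ⟨α, γ, β, δ, by rw [h]; ring⟩

lemma rotate (h : BiquadGen K s₁ s₂ s₃ a b c) : BiquadGen K s₂ s₃ s₁ b c a where
  sf₁ := by rw [mul_comm]; exact h.sf₂
  sf₂ := by rw [mul_comm]; exact h.sf₃
  sf₃ := h.sf₁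
  sq₁ := by rw [h.sq₂, mul_comm]
  sq₂ := by rw [h.sq₃, mul_comm]
  sq₃ := h.sq₁
  mul₁₂ := h.mul₂₃
  mul₂₃ := by rw [mul_comm, h.mul₁₃]
  mul₁₃ := by rw [mul_comm, h.mul₁₂]
  aut₁ := let ⟨σ, h1, h2, h3⟩ := h.aut₂; ⟨σ, h2, h3, h1⟩
  aut₂ := let ⟨σ, h1, h2, h3⟩ := h.aut₃; ⟨σ, h2, h3, h1⟩
  aut₃ := let ⟨σ, h1, h2, h3⟩ := h.aut₁; ⟨σ, h2, h3, h1⟩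
  span := fun x => by
    obtain ⟨α, β, γ, δ, h⟩ := h.span x
    exact ⟨α, γ, δ, β, by rw [h]; ring⟩

lemma s₁_ne_zero (h : BiquadGen K s₁ s₂ s₃ a b c) : s₁ ≠ 0 := by
  have : CharZero K := algebraRat.charZero K
  intro h0
  have := h.sq₁
  rw [h0] at this
  have h1 : b * c = 0 := by
    have : ((b * c : ℤ) : K) = 0 := by push_cast; rw [← this]; simp
    exact_mod_cast this
  exact not_squarefree_zero (h1 ▸ h.sf₁)

lemma linearIndependent (h : BiquadGen K s₁ s₂ s₃ a b c) :
    LinearIndependent ℚ ![1, s₁, s₂, s₃] := by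
  have : CharZero K := algebraRat.charZero K
  have n1 := h.s₁_ne_zero
  have n2 := h.rotate.s₁_ne_zero
  have n3 := h.rotate.rotate.s₁_ne_zero
  rw [Fintype.linearIndependent_iff]
  intro g hg
  simp only [Fin.sum_univ_four, Algebra.smul_def, eq_ratCast] at hg
  simp only [Matrix.cons_val_zero, Matrix.cons_val_one, Matrix.cons_val, mul_one] at hg
  obtain ⟨σ, a1, a2, a3⟩ := h.aut₁
  obtain ⟨τ, b1, b2, b3⟩ := h.aut₂
  obtain ⟨ρ, c1, c2, c3⟩ := h.aut₃
  have e1 := congrArg σ hg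
  have e2 := congrArg τ hg
  have e3 := congrArg ρ hg
  simp only [map_add, map_mul, map_ratCast, map_zero, a1, a2, a3, b1, b2, b3, c1, c2, c3]
    at e1 e2 e3
  have z0 : (4 : K) * g 0 = 0 := by linear_combination hg + e1 + e2 + e3
  have z1 : (4 : K) * s₁ * g 1 = 0 := by linear_combination hg + e1 - e2 - e3
  have z2 : (4 : K) * s₂ * g 2 = 0 := by linear_combination hg - e1 + e2 - e3
  have z3 : (4 : K) * s₃ * g 3 = 0 := by linear_combination hg - e1 - e2 + e3
  simp only [mul_eq_zero, n1, n2, n3, or_false, Rat.cast_eq_zero, OfNat.ofNat_ne_zero, false_or]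
    at z0 z1 z2 z3
  intro i
  fin_cases i <;> assumption

lemma top_le_span (h : BiquadGen K s₁ s₂ s₃ a b c) :
    ⊤ ≤ Submodule.span ℚ (Set.range ![1, s₁, s₂, s₃]) := by
  intro x _
  obtain ⟨α, β, γ, δ, rfl⟩ := h.span x
  rw [Submodule.mem_span_range_iff_exists_fun]
  exact ⟨![α, β, γ, δ], by simp [Fin.sum_univ_four, Algebra.smul_def]⟩

lemma finrank_eq (h : BiquadGen K s₁ s₂ s₃ a b c) : Module.finrank ℚ K = 4 := by
  rw [Module.finrank_eq_card_basis (Module.Basis.mk h.linearIndependent h.top_le_span)]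
  simp

lemma trace_s₁ (h : BiquadGen K s₁ s₂ s₃ a b c) : Algebra.trace ℚ K s₁ = 0 := by
  obtain ⟨σ, b1, b2, b3⟩ := h.aut₂
  have := Algebra.trace_eq_of_algEquiv σ s₁
  rw [b1, map_neg] at this
  linarith

lemma discr_basis (h : BiquadGen K s₁ s₂ s₃ a b c) :
    Algebra.discr ℚ ![1, s₁, s₂, s₃] = 256 * ((b * c) * (a * c) * (a * b) : ℤ) := by
  have t1 := h.trace_s₁
  have t2 := h.rotate.trace_s₁
  have t3 := h.rotate.rotate.trace_s₁
  have tr : ∀ r : ℤ, Algebra.trace ℚ K (r : K) = 4 * r := fun r => by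
    have := Algebra.trace_algebraMap (S := K) (r : ℚ)
    rw [h.finrank_eq] at this
    simpa using this
  have tm : ∀ (r : ℤ) (x : K), Algebra.trace ℚ K ((r : K) * x) = r * Algebra.trace ℚ K x :=
    fun r x => by
      have := (Algebra.trace ℚ K).map_smul (r : ℚ) x
      rw [Algebra.smul_def] at this
      simpa using this
  have t0 : Algebra.trace ℚ K (1 : K) = 4 := by simpa using tr 1
  have q1 : Algebra.trace ℚ K (s₁ * s₁) = 4 * (b * c) := by
    rw [← pow_two, h.sq₁]; exact_mod_cast tr (b * c)
  have q2 : Algebra.trace ℚ K (s₂ * s₂) = 4 * (a * c) := by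
    rw [← pow_two, h.sq₂]; exact_mod_cast tr (a * c)
  have q3 : Algebra.trace ℚ K (s₃ * s₃) = 4 * (a * b) := by
    rw [← pow_two, h.sq₃]; exact_mod_cast tr (a * b)
  have m12 : Algebra.trace ℚ K (s₁ * s₂) = 0 := by rw [h.mul₁₂, tm, t3, mul_zero]
  have m13 : Algebra.trace ℚ K (s₁ * s₃) = 0 := by rw [h.mul₁₃, tm, t2, mul_zero]
  have m23 : Algebra.trace ℚ K (s₂ * s₃) = 0 := by rw [h.mul₂₃, tm, t1, mul_zero]
  have : Algebra.traceMatrix ℚ ![1, s₁, s₂, s₃] =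
      Matrix.diagonal ![4, 4 * ((b : ℚ) * c), 4 * (a * c), 4 * (a * b)] := by
    ext i j
    rw [Algebra.traceMatrix_apply, Algebra.traceForm_apply]
    fin_cases i <;> fin_cases j <;>
      simp [t0, t1, t2, t3, q1, q2, q3, m12, m13, m23, mul_comm s₂ s₁, mul_comm s₃ s₁,
        mul_comm s₃ s₂]
  rw [Algebra.discr_def, this, Matrix.det_diagonal, Fin.prod_univ_four]
  simp
  ring

lemma isIntegral_s₁ (h : BiquadGen K s₁ s₂ s₃ a b c) : IsIntegral ℤ s₁ := by
  refine IsIntegral.of_pow (n := 2) (by norm_num) ?_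
  rw [h.sq₁]
  exact_mod_cast isIntegral_algebraMap (R := ℤ) (A := K) (x := b * c)

end Field

lemma _root_.exists_int_of_isIntegral_ratCast {K : Type*} [Field K] [Algebra ℚ K] {q : ℚ}
    (hq : IsIntegral ℤ (q : K)) : ∃ n : ℤ, q = n := by
  have h1 : IsIntegral ℤ (algebraMap ℚ K q) := by simpa using hq
  have h2 : IsIntegral ℤ q := (isIntegral_algebraMap_iff (algebraMap ℚ K).injective).1 h1
  obtain ⟨n, hn⟩ := IsIntegrallyClosed.isIntegral_iff.1 h2
  exact ⟨n, by simpa using hn.symm⟩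

lemma _root_.exists_int_of_sq_mul_squarefree {q : ℚ} {d n : ℤ} (hd : Squarefree d)
    (h : q ^ 2 * d = n) : ∃ m : ℤ, q = m := by
  have hden : (q.den : ℚ) ≠ 0 := by exact_mod_cast q.den_nz
  have h1 : q.num ^ 2 * d = (q.den : ℤ) ^ 2 * n := by
    rw [← Rat.num_div_den q] at h
    field_simp at h
    exact_mod_cast h
  have hcop : IsCoprime ((q.den : ℤ) ^ 2) (q.num ^ 2) := by
    refine IsCoprime.pow ?_
    rw [Int.isCoprime_iff_gcd_eq_one, Int.gcd_comm]
    exact q.reduced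
  have h2 : (q.den : ℤ) ^ 2 ∣ d := hcop.dvd_of_dvd_mul_left ⟨n, h1⟩
  have h3 := hd _ (by rwa [pow_two] at h2)
  have h4 : q.den = 1 := by
    have := Int.isUnit_iff.1 h3
    have := q.den_pos
    lia
  exact ⟨q.num, (Rat.den_eq_one_iff q).1 h4 |>.symm⟩

section Integral

variable {K : Type*} [Field K] [Algebra ℚ K] {s₁ s₂ s₃ : K} {a b c : ℤ}

lemma quadratic_integral (h : BiquadGen K s₁ s₂ s₃ a b c) {r w : ℚ}
    (hx : IsIntegral ℤ ((r : K) + w * s₁)) :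
    ∃ R W : ℤ, 2 * r = R ∧ 2 * w = W ∧ (4 : ℤ) ∣ R ^ 2 - W ^ 2 * (b * c) := by
  have : CharZero K := algebraRat.charZero K
  obtain ⟨τ, b1, -, -⟩ := h.aut₂
  have hx' : IsIntegral ℤ ((r : K) - w * s₁) := by
    have := hx.map (τ.toAlgHom.restrictScalars ℤ)
    simpa [b1, sub_eq_add_neg] using this
  obtain ⟨R, hR⟩ := exists_int_of_isIntegral_ratCast (K := K) (q := 2 * r) (by
    have e : ((2 * r : ℚ) : K) = (r + w * s₁) + (r - w * s₁) := by push_cast; ring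
    rw [e]
    exact hx.add hx')
  obtain ⟨N, hN⟩ := exists_int_of_isIntegral_ratCast (K := K) (q := r ^ 2 - w ^ 2 * (b * c)) (by
    have e : ((r ^ 2 - w ^ 2 * (b * c) : ℚ) : K) = (r + w * s₁) * (r - w * s₁) := by
      push_cast
      linear_combination (w : K) ^ 2 * h.sq₁
    rw [e]
    exact hx.mul hx')
  have hW : (2 * w) ^ 2 * ((b * c : ℤ) : ℚ) = ((R ^ 2 - 4 * N : ℤ) : ℚ) := by
    push_cast
    rw [← hR, ← hN]
    ring
  obtain ⟨W, hW'⟩ := exists_int_of_sq_mul_squarefree h.sf₁ hW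
  refine ⟨R, W, hR, hW', N, ?_⟩
  rw [hW'] at hW
  have : W ^ 2 * (b * c) = R ^ 2 - 4 * N := by exact_mod_cast hW
  rw [this]
  ring

lemma integral_part (h : BiquadGen K s₁ s₂ s₃ a b c) {α β γ δ : ℚ}
    (hx : IsIntegral ℤ ((α : K) + β * s₁ + γ * s₂ + δ * s₃)) :
    ∃ A B : ℤ, 4 * α = A ∧ 4 * β = B ∧ (4 : ℤ) ∣ A ^ 2 - B ^ 2 * (b * c) := by
  have : CharZero K := algebraRat.charZero K
  obtain ⟨σ, a1, a2, a3⟩ := h.aut₁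
  have hx' : IsIntegral ℤ ((α : K) + β * s₁ + γ * -s₂ + δ * -s₃) := by
    simpa only [AlgHom.coe_restrictScalars', AlgHom.coe_coe,
      AlgEquiv.coe_toAlgHom, map_add, map_mul, map_ratCast, a1, a2, a3]
      using hx.map (σ.toAlgHom.restrictScalars ℤ)
  obtain ⟨A, B, hA, hB, hAB⟩ := h.quadratic_integral (r := 2 * α) (w := 2 * β) (by
    have e : ((2 * α : ℚ) : K) + ((2 * β : ℚ) : K) * s₁ = ((α : K) + β * s₁ + γ * s₂ + δ * s₃)
        + ((α : K) + β * s₁ + γ * -s₂ + δ * -s₃) := by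
      push_cast
      ring
    rw [e]
    exact hx.add hx')
  exact ⟨A, B, by rw [← hA]; ring, by rw [← hB]; ring, hAB⟩

/-- The coordinates of an integral element, multiplied by `4`, are integers subject to
congruence conditions. -/
lemma integral_coords (h : BiquadGen K s₁ s₂ s₃ a b c) {x : K} (hx : IsIntegral ℤ x) :
    ∃ A B C D : ℤ, x = ((A / 4 : ℚ) : K) + ((B / 4 : ℚ) : K) * s₁ + ((C / 4 : ℚ) : K) * s₂
        + ((D / 4 : ℚ) : K) * s₃ ∧
      (4 : ℤ) ∣ A ^ 2 - B ^ 2 * (b * c) ∧ (4 : ℤ) ∣ A ^ 2 - C ^ 2 * (a * c) ∧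
      (4 : ℤ) ∣ A ^ 2 - D ^ 2 * (a * b) := by
  obtain ⟨α, β, γ, δ, rfl⟩ := h.span x
  obtain ⟨A, B, hA, hB, h1⟩ := h.integral_part hx
  obtain ⟨A', C, hA', hC, h2⟩ := h.rotate.integral_part (α := α) (β := γ) (γ := δ) (δ := β)
    (by convert hx using 1; ring)
  obtain ⟨A'', D, hA'', hD, h3⟩ := h.rotate.rotate.integral_part (α := α) (β := δ) (γ := β)
    (δ := γ) (by convert hx using 1; ring)
  have e1 : A' = A := by exact_mod_cast hA'.symm.trans hA
  have e2 : A'' = A := by exact_mod_cast hA''.symm.trans hA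
  subst e1 e2
  refine ⟨A'', B, C, D, ?_, h1, by rwa [mul_comm a c], h3⟩
  rw [← hA, ← hB, ← hC, ← hD]
  simp

end Integral

lemma discr_eq_of_integral_span {K : Type*} [Field K] [NumberField K] {s₁ s₂ s₃ : K} {a b c : ℤ}
    (h : BiquadGen K s₁ s₂ s₃ a b c) {P : Matrix (Fin 4) (Fin 4) ℚ} {v : Fin 4 → K}
    (hv : v = Matrix.mulVec (P.map (algebraMap ℚ K)) ![1, s₁, s₂, s₃])
    (hv_int : ∀ i, IsIntegral ℤ (v i))
    (hspan : ∀ x : K, IsIntegral ℤ x → ∃ n : Fin 4 → ℤ, x = ∑ i, (n i : K) * v i) :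
    (NumberField.discr K : ℚ) = P.det ^ 2 * (256 * ((b * c) * (a * c) * (a * b) : ℤ)) := by
  have hv_span : ⊤ ≤ Submodule.span ℚ (Set.range v) := by
    intro x _
    have hx : IsAlgebraic ℤ x :=
      (IsFractionRing.isAlgebraic_iff ℤ ℚ K).2 (Algebra.IsAlgebraic.isAlgebraic x)
    obtain ⟨y, hy0, hy⟩ := hx.exists_integral_multiple
    obtain ⟨n, hn⟩ := hspan _ hy
    rw [Submodule.mem_span_range_iff_exists_fun]
    refine ⟨fun i => n i / y, ?_⟩
    have hyK : (y : K) ≠ 0 := by exact_mod_cast hy0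
    refine mul_left_cancel₀ hyK ?_
    rw [← zsmul_eq_mul, ← zsmul_eq_mul, hn, zsmul_eq_mul, Finset.mul_sum]
    refine Finset.sum_congr rfl fun i _ => ?_
    simp only [Algebra.smul_def, map_div₀, eq_ratCast, Rat.cast_intCast]
    field_simp
  let B : Module.Basis (Fin 4) ℚ K := basisOfTopLeSpanOfCardEqFinrank v hv_span
    (by rw [h.finrank_eq]; rfl)
  have hB : ⇑B = v := coe_basisOfTopLeSpanOfCardEqFinrank _ _ _
  rw [NumberField.coe_discr, ← h.discr_basis, ← Algebra.discr_of_matrix_mulVec, ← hv, ← hB]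
  refine Algebra.discr_eq_discr_of_toMatrix_coeff_isIntegral K (fun i j => ?_) fun i j => ?_
  · rw [Module.Basis.toMatrix_apply, hB]
    have := NumberField.integralBasis_repr_apply K ⟨v j, hv_int j⟩ i
    rw [show algebraMap (NumberField.RingOfIntegers K) K ⟨v j, hv_int j⟩ = v j from rfl] at this
    rw [this]
    exact isIntegral_algebraMap
  · rw [Module.Basis.toMatrix_apply]
    obtain ⟨n, hn⟩ := hspan (NumberField.integralBasis K j) (by
      rw [NumberField.integralBasis_apply]
      exact NumberField.RingOfIntegers.isIntegral_coe _)
    rw [hn, ← hB]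
    have : B.repr (∑ k, (n k : K) * B k) i = n i := by
      have e : ∑ k, (n k : K) * B k = ∑ k, (n k : ℚ) • B k := by
        refine Finset.sum_congr rfl fun k _ => ?_
        simp [Algebra.smul_def]
      rw [e, B.repr_sum_self]
    rw [this]
    exact_mod_cast isIntegral_algebraMap (R := ℤ) (A := ℚ) (x := n i)

end BiquadGen

lemma Int.two_dvd_of_four_dvd_sq_sub {A C n : ℤ} (hn : n % 4 = 2 ∨ n % 4 = 3)
    (h : (4 : ℤ) ∣ A ^ 2 - C ^ 2 * n) : 2 ∣ A ∧ 2 ∣ C := by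
  have h := Int.emod_eq_zero_of_dvd h
  have hA : A % 4 = 0 ∨ A % 4 = 1 ∨ A % 4 = 2 ∨ A % 4 = 3 := by lia
  have hC : C % 4 = 0 ∨ C % 4 = 1 ∨ C % 4 = 2 ∨ C % 4 = 3 := by lia
  rcases hn with hn | hn <;> rcases hA with hA | hA | hA | hA <;>
    rcases hC with hC | hC | hC | hC <;>
    first
    | (exfalso; revert h; simp [pow_two, Int.sub_emod, Int.mul_emod, *]; done)
    | lia

lemma Int.two_dvd_sub_of_four_dvd_sq_sub {A C n : ℤ} (hn : n % 4 = 1)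
    (h : (4 : ℤ) ∣ A ^ 2 - C ^ 2 * n) : 2 ∣ A - C := by
  have h := Int.emod_eq_zero_of_dvd h
  have hA : A % 4 = 0 ∨ A % 4 = 1 ∨ A % 4 = 2 ∨ A % 4 = 3 := by lia
  have hC : C % 4 = 0 ∨ C % 4 = 1 ∨ C % 4 = 2 ∨ C % 4 = 3 := by lia
  rcases hA with hA | hA | hA | hA <;> rcases hC with hC | hC | hC | hC <;>
    first
    | (exfalso; revert h; simp [pow_two, Int.sub_emod, Int.mul_emod, *]; done)
    | lia

lemma Int.two_dvd_of_four_dvd_mixed {A B C l n : ℤ} (hl : l % 4 = 3) (hn : n % 4 = 2)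
    (h : (4 : ℤ) ∣ A ^ 2 + B ^ 2 * l - C ^ 2 * n) (hAB : 2 ∣ A * B) : 2 ∣ A ∧ 2 ∣ B ∧ 2 ∣ C := by
  have h := Int.emod_eq_zero_of_dvd h
  have hA : A % 4 = 0 ∨ A % 4 = 1 ∨ A % 4 = 2 ∨ A % 4 = 3 := by lia
  have hB : B % 4 = 0 ∨ B % 4 = 1 ∨ B % 4 = 2 ∨ B % 4 = 3 := by lia
  have hC : C % 4 = 0 ∨ C % 4 = 1 ∨ C % 4 = 2 ∨ C % 4 = 3 := by lia
  rcases (Int.prime_two.dvd_mul).1 hAB with h2 | h2 <;>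
  rcases hA with hA | hA | hA | hA <;> rcases hB with hB | hB | hB | hB <;>
    rcases hC with hC | hC | hC | hC <;>
    first
    | lia
    | (exfalso; revert h; simp [pow_two, Int.sub_emod, Int.add_emod, Int.mul_emod, *])

namespace BiquadGen

variable {K : Type*} [Field K] [NumberField K] {s₁ s₂ s₃ : K} {a b c : ℤ}

lemma isIntegral_half (h : BiquadGen K s₁ s₂ s₃ a b c) (hbc : (b * c) % 4 = 1) :
    IsIntegral ℤ ((1 + s₁) / 2) := by
  obtain ⟨k, hk⟩ : ∃ k, b * c = 4 * k + 1 := ⟨(b * c) / 4, by lia⟩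
  have hk' : (b : K) * c = 4 * k + 1 := by exact_mod_cast hk
  have e : ((1 + s₁) / 2) ^ 2 - (1 + s₁) / 2 - k = 0 := by
    linear_combination h.sq₁ / 4 + hk' / 4
  refine ⟨Polynomial.X ^ 2 - Polynomial.X - Polynomial.C k, ?_, ?_⟩
  · rw [sub_sub]
    exact Polynomial.monic_X_pow_sub (by rw [Polynomial.degree_X_add_C]; norm_num)
  · rw [Polynomial.eval₂_sub, Polynomial.eval₂_C]
    simpa using e

lemma det_of_lower {P : Matrix (Fin 4) (Fin 4) ℚ} (h : ∀ i j, i < j → P i j = 0) :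
    P.det = P 0 0 * P 1 1 * P 2 2 * P 3 3 := by
  rw [Matrix.det_of_isLowerTriangular P (fun i j hij => h i j hij), Fin.prod_univ_four]

lemma discr_of_one (h : BiquadGen K s₁ s₂ s₃ a b c) (h1 : (b * c) % 4 = 1)
    (h2 : (a * c) % 4 = 1) (h3 : (a * b) % 4 = 1) : NumberField.discr K = (a * b * c) ^ 2 := by
  have hc : c % 2 = 1 := by
    by_contra hc
    have : (2 : ℤ) ∣ b * c := Dvd.dvd.mul_left (by lia) _
    lia
  obtain ⟨l, hl⟩ : ∃ l, c ^ 2 = 4 * l + 1 := by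
    obtain ⟨m, rfl⟩ : ∃ m, c = 2 * m + 1 := ⟨c / 2, by lia⟩
    exact ⟨m ^ 2 + m, by ring⟩
  have hl' : (c : K) ^ 2 = 4 * l + 1 := by exact_mod_cast hl
  have i1 := h.isIntegral_half h1
  have i2 := h.swap.isIntegral_half h2
  have i3 := h.rotate.rotate.isIntegral_s₁
  have i4 : IsIntegral ℤ ((c + c * s₁ + c * s₂ + s₃) / 4) := by
    have e : (c + c * s₁ + c * s₂ + s₃) / 4 =
        (c : K) * ((1 + s₁) / 2 * ((1 + s₂) / 2)) - l * s₃ := by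
      linear_combination - (c : K) / 4 * h.mul₁₂ - s₃ / 4 * hl'
    rw [e]
    exact ((isIntegral_intCast c).mul (i1.mul i2)).sub ((isIntegral_intCast l).mul i3)
  have key := h.discr_eq_of_integral_span
    (P := !![1, 0, 0, 0; 1 / 2, 1 / 2, 0, 0; 1 / 2, 0, 1 / 2, 0; c / 4, c / 4, c / 4, 1 / 4])
    (v := ![1, (1 + s₁) / 2, (1 + s₂) / 2, (c + c * s₁ + c * s₂ + s₃) / 4]) (by
      ext i
      fin_cases i <;> simp [Matrix.mulVec, dotProduct, Fin.sum_univ_four] <;> ring) (by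
      intro i
      fin_cases i
      · exact isIntegral_one
      · exact i1
      · exact i2
      · exact i4) (by
      intro x hx
      obtain ⟨A, B, C, D, rfl, hB, hC, hD⟩ := h.integral_coords hx
      have hB := Int.two_dvd_sub_of_four_dvd_sq_sub h1 hB
      have hC := Int.two_dvd_sub_of_four_dvd_sq_sub h2 hC
      have hD := Int.two_dvd_sub_of_four_dvd_sq_sub h3 hD
      have hDc : 2 ∣ D - D * c := by
        rw [show D - D * c = D * (1 - c) by ring]
        exact Dvd.dvd.mul_left (by lia) _
      obtain ⟨p, hp⟩ : 2 ∣ A - D * c := by lia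
      obtain ⟨q, hq⟩ : 2 ∣ B - D * c := by lia
      obtain ⟨r, hr⟩ : 2 ∣ C - D * c := by lia
      have hp' : (A : K) = 2 * p + D * c := by exact_mod_cast (by lia : A = 2 * p + D * c)
      have hq' : (B : K) = 2 * q + D * c := by exact_mod_cast (by lia : B = 2 * q + D * c)
      have hr' : (C : K) = 2 * r + D * c := by exact_mod_cast (by lia : C = 2 * r + D * c)
      have hm : IsIntegral ℤ ((((p - q - r : ℤ) / 2 : ℚ)) : K) := by
        have e : ((((p - q - r : ℤ) / 2 : ℚ)) : K) =
            ((A / 4 : ℚ) : K) + ((B / 4 : ℚ) : K) * s₁ + ((C / 4 : ℚ) : K) * s₂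
            + ((D / 4 : ℚ) : K) * s₃ - q * ((1 + s₁) / 2) - r * ((1 + s₂) / 2)
            - D * ((c + c * s₁ + c * s₂ + s₃) / 4) := by
          push_cast
          linear_combination -hp' / 4 - s₁ / 4 * hq' - s₂ / 4 * hr'
        rw [e]
        exact ((hx.sub ((isIntegral_intCast q).mul i1)).sub ((isIntegral_intCast r).mul i2)).sub
          ((isIntegral_intCast D).mul i4)
      obtain ⟨m, hm⟩ := exists_int_of_isIntegral_ratCast hm
      have hm' : (p : K) - q - r = 2 * m := by
        have : p - q - r = 2 * m := by
          have : ((p - q - r : ℤ) : ℚ) = 2 * m := by rw [← hm]; ring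
          exact_mod_cast this
        exact_mod_cast this
      refine ⟨![m, q, r, D], ?_⟩
      simp [Fin.sum_univ_four]
      linear_combination hp' / 4 + s₁ / 4 * hq' + s₂ / 4 * hr' + hm' / 2)
  rw [det_of_lower (by intro i j hij; fin_cases i <;> fin_cases j <;> simp_all)] at key
  have : (NumberField.discr K : ℚ) = (a * b * c) ^ 2 := by
    rw [key]
    simp
    ring
  exact_mod_cast this

lemma discr_of_half (h : BiquadGen K s₁ s₂ s₃ a b c) (h1 : (b * c) % 4 = 1)
    (h2 : (a * c) % 4 = 2 ∨ (a * c) % 4 = 3) (h3 : (a * b) % 4 = 2 ∨ (a * b) % 4 = 3) :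
    NumberField.discr K = (4 * (a * b * c)) ^ 2 := by
  have hc : c % 2 = 1 := by
    by_contra hc
    have : (2 : ℤ) ∣ b * c := Dvd.dvd.mul_left (by lia) _
    lia
  obtain ⟨l, hl⟩ : ∃ l, c = 2 * l + 1 := ⟨c / 2, by lia⟩
  have hl' : (c : K) = 2 * l + 1 := by exact_mod_cast hl
  have i1 := h.isIntegral_half h1
  have i2 := h.rotate.isIntegral_s₁
  have i3 := h.rotate.rotate.isIntegral_s₁
  have i4 : IsIntegral ℤ ((s₂ + s₃) / 2) := by
    have e : (s₂ + s₃) / 2 = s₂ * ((1 + s₁) / 2) - l * s₃ := by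
      linear_combination -h.mul₁₂ / 2 - s₃ / 2 * hl'
    rw [e]
    exact (i2.mul i1).sub ((isIntegral_intCast l).mul i3)
  have key := h.discr_eq_of_integral_span
    (P := !![1, 0, 0, 0; 1 / 2, 1 / 2, 0, 0; 0, 0, 1, 0; 0, 0, 1 / 2, 1 / 2])
    (v := ![1, (1 + s₁) / 2, s₂, (s₂ + s₃) / 2]) (by
      ext i
      fin_cases i <;> simp [Matrix.mulVec, dotProduct, Fin.sum_univ_four] <;> ring) (by
      intro i
      fin_cases i
      · exact isIntegral_one
      · exact i1
      · exact i2
      · exact i4) (by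
      intro x hx
      obtain ⟨A, B, C, D, rfl, hB, hC, hD⟩ := h.integral_coords hx
      replace hB := Int.two_dvd_sub_of_four_dvd_sq_sub h1 hB
      obtain ⟨hA, hC'⟩ := Int.two_dvd_of_four_dvd_sq_sub h2 hC
      replace hD := (Int.two_dvd_of_four_dvd_sq_sub h3 hD).2
      clear hC
      obtain ⟨A, rfl⟩ := hA
      obtain ⟨B, rfl⟩ : 2 ∣ B := by lia
      obtain ⟨C, rfl⟩ := hC'
      obtain ⟨D, rfl⟩ := hD
      have hm : IsIntegral ℤ ((((A - B : ℤ) / 2 : ℚ)) + (((C - D : ℤ) / 2 : ℚ)) * s₂ : K) := by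
        have e : ((((A - B : ℤ) / 2 : ℚ)) + (((C - D : ℤ) / 2 : ℚ)) * s₂ : K) =
            (((2 * A : ℤ) / 4 : ℚ) : K) + (((2 * B : ℤ) / 4 : ℚ) : K) * s₁
            + (((2 * C : ℤ) / 4 : ℚ) : K) * s₂ + (((2 * D : ℤ) / 4 : ℚ) : K) * s₃
            - B * ((1 + s₁) / 2) - D * ((s₂ + s₃) / 2) := by
          push_cast
          ring
        rw [e]
        exact (hx.sub ((isIntegral_intCast B).mul i1)).sub ((isIntegral_intCast D).mul i4)
      obtain ⟨R, W, hR, hW, hRW⟩ := h.swap.quadratic_integral hm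
      have hR : A - B = R := by
        have : ((A - B : ℤ) : ℚ) = R := by rw [← hR]; ring
        exact_mod_cast this
      have hW : C - D = W := by
        have : ((C - D : ℤ) : ℚ) = W := by rw [← hW]; ring
        exact_mod_cast this
      obtain ⟨⟨m, rfl⟩, n, rfl⟩ := Int.two_dvd_of_four_dvd_sq_sub h2 hRW
      obtain rfl : A = 2 * m + B := by lia
      obtain rfl : C = 2 * n + D := by lia
      refine ⟨![m, B, n, D], ?_⟩
      simp [Fin.sum_univ_four]
      ring)
  rw [det_of_lower (by intro i j hij; fin_cases i <;> fin_cases j <;> simp_all)] at key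
  have : (NumberField.discr K : ℚ) = (4 * (a * b * c)) ^ 2 := by
    rw [key]
    simp
    ring
  exact_mod_cast this

lemma discr_of_three (h : BiquadGen K s₁ s₂ s₃ a b c) (h1 : (b * c) % 4 = 3)
    (h2 : (a * c) % 4 = 2) (h3 : (a * b) % 4 = 2) :
    NumberField.discr K = (8 * (a * b * c)) ^ 2 := by
  have hbc : b * c % 2 = 1 := by lia
  have hb : b % 2 = 1 := by
    by_contra hc
    have : (2 : ℤ) ∣ b * c := Dvd.dvd.mul_right (by lia) _
    lia
  have hc : c % 2 = 1 := by
    by_contra hc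
    have : (2 : ℤ) ∣ b * c := Dvd.dvd.mul_left (by lia) _
    lia
  obtain ⟨a', ha⟩ : ∃ a', a = 2 * a' := by
    have : (2 : ℤ) ∣ a * c := by lia
    rcases Int.prime_two.dvd_mul.1 this with h | h
    · exact h
    · lia
  obtain ⟨l, hl⟩ : ∃ l, b + c = 2 * l := ⟨(b + c) / 2, by lia⟩
  have ha' : (a : K) = 2 * a' := by exact_mod_cast ha
  have hl' : (b : K) + c = 2 * l := by exact_mod_cast hl
  have i1 := h.isIntegral_s₁
  have i2 := h.rotate.isIntegral_s₁
  have i4 : IsIntegral ℤ ((s₂ + s₃) / 2) := by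
    refine IsIntegral.of_pow (n := 2) (by norm_num) ?_
    have e : ((s₂ + s₃) / 2) ^ 2 = a' * l + a' * s₁ := by
      linear_combination h.sq₂ / 4 + h.sq₃ / 4 + h.mul₂₃ / 2 + (b + c + 2 * s₁) / 4 * ha'
        + a' / 2 * hl'
    rw [e]
    exact ((isIntegral_intCast a').mul (isIntegral_intCast l)).add
      ((isIntegral_intCast a').mul i1)
  have key := h.discr_eq_of_integral_span
    (P := !![1, 0, 0, 0; 0, 1, 0, 0; 0, 0, 1, 0; 0, 0, 1 / 2, 1 / 2])
    (v := ![1, s₁, s₂, (s₂ + s₃) / 2]) (by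
      ext i
      fin_cases i <;> simp [Matrix.mulVec, dotProduct, Fin.sum_univ_four] <;> ring) (by
      intro i
      fin_cases i
      · exact isIntegral_one
      · exact i1
      · exact i2
      · exact i4) (by
      intro x hx
      obtain ⟨A, B, C, D, rfl, hB, hC, hD⟩ := h.integral_coords hx
      replace hB := (Int.two_dvd_of_four_dvd_sq_sub (.inr h1) hB).2
      obtain ⟨hA, hC'⟩ := Int.two_dvd_of_four_dvd_sq_sub (.inl h2) hC
      replace hD := (Int.two_dvd_of_four_dvd_sq_sub (.inl h3) hD).2
      clear hC
      obtain ⟨A, rfl⟩ := hA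
      obtain ⟨B, rfl⟩ := hB
      obtain ⟨C, rfl⟩ := hC'
      obtain ⟨D, rfl⟩ := hD
      have hy : IsIntegral ℤ ((A + B * s₁ + (C - D) * s₂ : K) / 2) := by
        have e : (A + B * s₁ + (C - D) * s₂ : K) / 2 =
            (((2 * A : ℤ) / 4 : ℚ) : K) + (((2 * B : ℤ) / 4 : ℚ) : K) * s₁
            + (((2 * C : ℤ) / 4 : ℚ) : K) * s₂ + (((2 * D : ℤ) / 4 : ℚ) : K) * s₃
            - D * ((s₂ + s₃) / 2) := by
          push_cast
          ring
        rw [e]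
        exact hx.sub ((isIntegral_intCast D).mul i4)
      obtain ⟨σ, a1, a2, -⟩ := h.aut₁
      have hy' : IsIntegral ℤ ((A + B * s₁ + (C - D) * -s₂ : K) / 2) := by
        simpa only [AlgHom.coe_restrictScalars', AlgHom.coe_coe,
          AlgEquiv.coe_toAlgHom, map_add, map_sub, map_div₀, map_mul, map_intCast, map_ofNat, a1,
          a2] using hy.map (σ.toAlgHom.restrictScalars ℤ)
      have hm : IsIntegral ℤ ((((A ^ 2 + B ^ 2 * (b * c) - (C - D) ^ 2 * (a * c) : ℤ) / 4 : ℚ))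
          + (((A * B : ℤ) / 2 : ℚ)) * s₁ : K) := by
        have e : ((((A ^ 2 + B ^ 2 * (b * c) - (C - D) ^ 2 * (a * c) : ℤ) / 4 : ℚ))
          + (((A * B : ℤ) / 2 : ℚ)) * s₁ : K) =
            (A + B * s₁ + (C - D) * s₂ : K) / 2 * ((A + B * s₁ + (C - D) * -s₂ : K) / 2) := by
          push_cast
          linear_combination -(B : K) ^ 2 / 4 * h.sq₁ + ((C : K) - D) ^ 2 / 4 * h.sq₂
        rw [e]
        exact hy.mul hy'
      obtain ⟨R, W, hR, hW, hRW⟩ := h.quadratic_integral hm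
      have hR : A ^ 2 + B ^ 2 * (b * c) - (C - D) ^ 2 * (a * c) = 2 * R := by
        have : ((A ^ 2 + B ^ 2 * (b * c) - (C - D) ^ 2 * (a * c) : ℤ) : ℚ) = 2 * R := by
          rw [← hR]; ring
        exact_mod_cast this
      have hW : A * B = W := by
        have : ((A * B : ℤ) : ℚ) = W := by rw [← hW]; ring
        exact_mod_cast this
      obtain ⟨hR2, hW2⟩ := Int.two_dvd_of_four_dvd_sq_sub (.inr h1) hRW
      obtain ⟨⟨A, rfl⟩, ⟨B, rfl⟩, n, hn⟩ := Int.two_dvd_of_four_dvd_mixed h1 h2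
        (by rw [hR]; lia) (by rwa [hW])
      obtain rfl : C = 2 * n + D := by lia
      refine ⟨![A, B, n, D], ?_⟩
      simp [Fin.sum_univ_four]
      ring)
  rw [det_of_lower (by intro i j hij; fin_cases i <;> fin_cases j <;> simp_all)] at key
  have : (NumberField.discr K : ℚ) = (8 * (a * b * c)) ^ 2 := by
    rw [key]
    simp
    ring
  exact_mod_cast this

end BiquadGen

/-- The square root of the discriminant of `ℚ(√(bc), √(ac))`, divided by `|abc|`. -/
def ramFactor (a b c : ℤ) : ℕ :=
  if (b * c) % 4 = 1 ∧ (a * c) % 4 = 1 ∧ (a * b) % 4 = 1 then 1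
  else if (b * c) % 4 = 1 ∨ (a * c) % 4 = 1 ∨ (a * b) % 4 = 1 then 4
  else 8

lemma Squarefree.int_emod_four_ne_zero {n : ℤ} (h : Squarefree n) : n % 4 ≠ 0 := by
  intro h0
  have h2 := h 2 (by lia)
  rw [Int.isUnit_iff] at h2
  lia

lemma Int.emod_four_mul_cases {a b c : ℤ} (h1 : (b * c) % 4 ≠ 0) (h2 : (a * c) % 4 ≠ 0)
    (h3 : (a * b) % 4 ≠ 0) :
    ((b * c) % 4 = 1 ∧ (a * c) % 4 = 1 ∧ (a * b) % 4 = 1) ∨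
    ((b * c) % 4 = 1 ∧ ((a * c) % 4 = 2 ∨ (a * c) % 4 = 3) ∧
      ((a * b) % 4 = 2 ∨ (a * b) % 4 = 3)) ∨
    ((a * c) % 4 = 1 ∧ ((b * c) % 4 = 2 ∨ (b * c) % 4 = 3) ∧
      ((a * b) % 4 = 2 ∨ (a * b) % 4 = 3)) ∨
    ((a * b) % 4 = 1 ∧ ((b * c) % 4 = 2 ∨ (b * c) % 4 = 3) ∧
      ((a * c) % 4 = 2 ∨ (a * c) % 4 = 3)) ∨
    ((b * c) % 4 = 3 ∧ (a * c) % 4 = 2 ∧ (a * b) % 4 = 2) ∨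
    ((a * c) % 4 = 3 ∧ (b * c) % 4 = 2 ∧ (a * b) % 4 = 2) ∨
    ((a * b) % 4 = 3 ∧ (b * c) % 4 = 2 ∧ (a * c) % 4 = 2) := by
  have hA : a % 4 = 0 ∨ a % 4 = 1 ∨ a % 4 = 2 ∨ a % 4 = 3 := by lia
  have hB : b % 4 = 0 ∨ b % 4 = 1 ∨ b % 4 = 2 ∨ b % 4 = 3 := by lia
  have hC : c % 4 = 0 ∨ c % 4 = 1 ∨ c % 4 = 2 ∨ c % 4 = 3 := by lia
  rw [Int.mul_emod] at h1 h2 h3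
  rw [Int.mul_emod b c, Int.mul_emod a c, Int.mul_emod a b]
  rcases hA with hA | hA | hA | hA <;> rcases hB with hB | hB | hB | hB <;>
    rcases hC with hC | hC | hC | hC <;> simp_all

namespace BiquadGen

variable {K : Type*} [Field K] [NumberField K] {s₁ s₂ s₃ : K} {a b c : ℤ}

lemma discr_eq (h : BiquadGen K s₁ s₂ s₃ a b c) :
    NumberField.discr K = (ramFactor a b c * (a * b * c)) ^ 2 := by
  rcases Int.emod_four_mul_cases h.sf₁.int_emod_four_ne_zero h.sf₂.int_emod_four_ne_zero
    h.sf₃.int_emod_four_ne_zero with ⟨h1, h2, h3⟩ | ⟨h1, h2, h3⟩ | ⟨h1, h2, h3⟩ | ⟨h1, h2, h3⟩ |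
      ⟨h1, h2, h3⟩ | ⟨h1, h2, h3⟩ | ⟨h1, h2, h3⟩
  · rw [h.discr_of_one h1 h2 h3, ramFactor, if_pos ⟨h1, h2, h3⟩]
    simp
  · rw [h.discr_of_half h1 h2 h3, ramFactor, if_neg (by lia), if_pos (by lia)]
    simp
  · rw [h.swap.discr_of_half h1 h2 (by rwa [mul_comm]), ramFactor, if_neg (by lia),
      if_pos (by lia)]
    push_cast
    ring
  · rw [h.rotate.rotate.discr_of_half h1 (by rwa [mul_comm]) (by rwa [mul_comm]), ramFactor,
      if_neg (by lia), if_pos (by lia)]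
    push_cast
    ring
  · rw [h.discr_of_three h1 h2 h3, ramFactor, if_neg (by lia), if_neg (by lia)]
    simp
  · rw [h.swap.discr_of_three h1 h2 (by rwa [mul_comm]), ramFactor, if_neg (by lia),
      if_neg (by lia)]
    push_cast
    ring
  · rw [h.rotate.rotate.discr_of_three h1 (by rwa [mul_comm]) (by rwa [mul_comm]), ramFactor,
      if_neg (by lia), if_neg (by lia)]
    push_cast
    ring

end BiquadGen

lemma eq_of_sq_mul_squarefree {q : ℚ} {m n : ℤ} (hm : Squarefree m) (hn : Squarefree n)
    (h : q ^ 2 * m = n) : m = n := by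
  obtain ⟨k, rfl⟩ := exists_int_of_sq_mul_squarefree hm h
  have h : k ^ 2 * m = n := by exact_mod_cast h
  have hk := hn k ⟨m, by rw [← h]; ring⟩
  rcases Int.isUnit_iff.1 hk with rfl | rfl <;> lia

section Aut

variable {K : Type*} [Field K] [Algebra ℚ K]

lemma map_eq_or_eq_neg (σ : K ≃ₐ[ℚ] K) {s : K} {d : ℤ} (hs : s ^ 2 = d) :
    σ s = s ∨ σ s = -s := by
  refine sq_eq_sq_iff_eq_or_eq_neg.1 ?_
  rw [← map_pow, hs, map_intCast]

lemma exists_map_eq_neg [FiniteDimensional ℚ K] [IsGalois ℚ K] {s : K} {d : ℤ} (hs : s ^ 2 = d)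
    (hd : Squarefree d) (hd1 : d ≠ 1) : ∃ σ : K ≃ₐ[ℚ] K, σ s = -s := by
  have : CharZero K := algebraRat.charZero K
  by_contra! hcon
  have hfix : ∀ σ : K ≃ₐ[ℚ] K, σ s = s := fun σ =>
    (map_eq_or_eq_neg σ hs).resolve_right (hcon σ)
  obtain ⟨q, hq⟩ := (IsGalois.mem_range_algebraMap_iff_fixed s).2 hfix
  apply hd1
  refine (eq_of_sq_mul_squarefree (q := q) squarefree_one hd ?_).symm
  have : ((q ^ 2 : ℚ) : K) = ((d : ℚ) : K) := by
    push_cast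
    rw [← hs, ← hq]
    simp
  rw [Int.cast_one, mul_one]
  exact_mod_cast this

lemma exists_aut_signs {s₁ s₂ s₃ : K} {a d₂ d₃ : ℤ} (h₂ : s₂ ^ 2 = d₂)
    (h₃ : s₃ ^ 2 = d₃) (hm : s₂ * s₃ = a * s₁) (ha : a ≠ 0)
    (e₂ : ∃ σ : K ≃ₐ[ℚ] K, σ s₂ = -s₂) (e₃ : ∃ σ : K ≃ₐ[ℚ] K, σ s₃ = -s₃) :
    ∃ σ : K ≃ₐ[ℚ] K, σ s₁ = s₁ ∧ σ s₂ = -s₂ ∧ σ s₃ = -s₃ := by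
  have : CharZero K := algebraRat.charZero K
  have ha' : (a : K) ≠ 0 := by exact_mod_cast ha
  have key : ∀ σ : K ≃ₐ[ℚ] K, σ s₂ = -s₂ → σ s₃ = -s₃ → σ s₁ = s₁ := fun σ h2 h3 => by
    refine mul_left_cancel₀ ha' ?_
    have := congrArg σ hm
    rw [map_mul, map_mul, map_intCast, h2, h3, neg_mul_neg, hm] at this
    exact this.symm
  obtain ⟨σ, hσ⟩ := e₂
  obtain ⟨τ, hτ⟩ := e₃
  rcases map_eq_or_eq_neg σ h₃ with hσ3 | hσ3
  · rcases map_eq_or_eq_neg τ h₂ with hτ2 | hτ2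
    · have i2 : (σ * τ) s₂ = -s₂ := by simp [hσ, hτ2]
      have i3 : (σ * τ) s₃ = -s₃ := by simp [hσ3, hτ]
      exact ⟨σ * τ, key _ i2 i3, i2, i3⟩
    · exact ⟨τ, key _ hτ2 hτ, hτ2, hτ⟩
  · exact ⟨σ, key _ hσ hσ3, hσ, hσ3⟩

end Aut

namespace BiquadGen

/-- Two independent square roots generating a Galois extension give a `BiquadGen`. -/
lemma of_isGalois {K : Type*} [Field K] [Algebra ℚ K] [FiniteDimensional ℚ K] [IsGalois ℚ K]
    {s t : K} {a b c : ℤ} (sf : Squarefree (a * b * c)) (h1 : b * c ≠ 1) (h2 : a * c ≠ 1)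
    (h3 : a ≠ b) (hc : 0 < c) (hs : s ^ 2 = b * c) (ht : t ^ 2 = a * c)
    (hspan : ∀ x : K, ∃ α β γ δ : ℚ, x = α + β * s + γ * t + δ * (s * t)) :
    BiquadGen K s t (s * t / c) a b c := by
  have : CharZero K := algebraRat.charZero K
  have sf₁ : Squarefree (b * c) := sf.squarefree_of_dvd ⟨a, by ring⟩
  have sf₂ : Squarefree (a * c) := sf.squarefree_of_dvd ⟨b, by ring⟩
  have sf₃ : Squarefree (a * b) := sf.squarefree_of_dvd ⟨c, by ring⟩
  have ha : a ≠ 0 := by rintro rfl; simp at sf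
  have hb : b ≠ 0 := by rintro rfl; simp at sf
  have hcK : (c : K) ≠ 0 := by exact_mod_cast hc.ne'
  have n3 : a * b ≠ 1 := fun h => h3 (by
    rcases Int.mul_eq_one_iff_eq_one_or_neg_one.1 h with ⟨rfl, rfl⟩ | ⟨rfl, rfl⟩ <;> rfl)
  have hu : (s * t / c) ^ 2 = a * b := by
    field_simp
    rw [hs, ht]
    ring
  have m1 : s * t = c * (s * t / c) := by field_simp
  have m2 : t * (s * t / c) = a * s := by
    field_simp
    rw [ht]
    ring
  have m3 : s * (s * t / c) = b * t := by
    field_simp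
    rw [hs]
    ring
  have hs' : s ^ 2 = (b * c : ℤ) := by rw [hs]; push_cast; rfl
  have ht' : t ^ 2 = (a * c : ℤ) := by rw [ht]; push_cast; rfl
  have hu' : (s * t / c) ^ 2 = (a * b : ℤ) := by rw [hu]; push_cast; rfl
  have e1 := exists_map_eq_neg hs' sf₁ h1
  have e2 := exists_map_eq_neg ht' sf₂ h2
  have e3 := exists_map_eq_neg hu' sf₃ n3
  refine ⟨sf₁, sf₂, sf₃, hs, ht, hu, m1, m2, m3, exists_aut_signs ht' hu' m2 ha e2 e3, ?_, ?_,
    ?_⟩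
  · obtain ⟨σ, h1, h2, h3⟩ := exists_aut_signs hs' hu' m3 hb e1 e3
    exact ⟨σ, h2, h1, h3⟩
  · obtain ⟨σ, h1, h2, h3⟩ := exists_aut_signs hs' ht' m1 hc.ne' e1 e2
    exact ⟨σ, h2, h3, h1⟩
  · intro x
    obtain ⟨α, β, γ, δ, rfl⟩ := hspan x
    refine ⟨α, β, γ, δ * c, ?_⟩
    push_cast
    rw [mul_assoc (δ : K), ← m1]

variable {K : Type*} [Field K] [Algebra ℚ K] {s₁ s₂ s₃ : K} {a b c : ℤ}

/-- The squarefree integers having a square root in a biquadratic field. -/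
lemma eq_of_sq_eq (h : BiquadGen K s₁ s₂ s₃ a b c) {u : K} {d : ℤ} (hu : u ^ 2 = d)
    (hd : Squarefree d) (hd1 : d ≠ 1) : d = b * c ∨ d = a * c ∨ d = a * b := by
  have : CharZero K := algebraRat.charZero K
  obtain ⟨α, β, γ, δ, e⟩ := h.span u
  obtain ⟨σ, a1, a2, a3⟩ := h.aut₁
  obtain ⟨τ, b1, b2, b3⟩ := h.aut₂
  have fin : ∀ {r : ℚ} {m : ℤ} {s : K}, Squarefree m → s ^ 2 = m → u = r * s → d = m :=
    fun {r m s} hm hs he => by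
      refine (eq_of_sq_mul_squarefree (q := r) hm hd ?_).symm
      have : ((r ^ 2 * m : ℚ) : K) = ((d : ℚ) : K) := by
        push_cast
        rw [← hs, ← hu, he]
        ring
      exact_mod_cast this
  have eσ : σ u = α + β * s₁ - γ * s₂ - δ * s₃ := by
    rw [e]; simp [a1, a2, a3]; ring
  have eτ : τ u = α - β * s₁ + γ * s₂ - δ * s₃ := by
    rw [e]; simp [b1, b2, b3]; ring
  have eστ : σ (τ u) = α - β * s₁ - γ * s₂ + δ * s₃ := by
    rw [eτ]; simp [a1, a2, a3]; ring
  rcases map_eq_or_eq_neg σ hu with hσ | hσ <;> rcases map_eq_or_eq_neg τ hu with hτ | hτ <;>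
    rw [hτ] at eστ eτ <;> try rw [map_neg] at eστ
  all_goals rw [hσ] at eστ eσ
  · exact absurd (fin (r := α) squarefree_one (s := 1) (by simp)
      (by linear_combination (e + eσ + eτ + eστ) / 4)) hd1
  · exact .inl (fin (r := β) h.sf₁ (by rw [h.sq₁]; push_cast; rfl)
      (by linear_combination (e + eσ - eτ - eστ) / 4))
  · exact .inr (.inl (fin (r := γ) h.sf₂ (by rw [h.sq₂]; push_cast; rfl)
      (by linear_combination (e - eσ + eτ - eστ) / 4)))
  · exact .inr (.inr (fin (r := δ) h.sf₃ (by rw [h.sq₃]; push_cast; rfl)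
      (by linear_combination (e - eσ - eτ + eστ) / 4)))

lemma isKleinFour [FiniteDimensional ℚ K] [IsGalois ℚ K] (h : BiquadGen K s₁ s₂ s₃ a b c) :
    IsKleinFour (K ≃ₐ[ℚ] K) := by
  have hc : Nat.card (K ≃ₐ[ℚ] K) = 4 := (IsGalois.card_aut_eq_finrank ℚ K).trans h.finrank_eq
  refine ⟨hc, ?_⟩
  have : Nontrivial (K ≃ₐ[ℚ] K) := Finite.one_lt_card_iff_nontrivial.1 (by rw [hc]; norm_num)
  rw [Monoid.exponent_eq_prime_iff Nat.prime_two]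
  intro σ hσ
  refine orderOf_eq_prime ?_ hσ
  have key : ∀ {s : K} {d : ℤ}, s ^ 2 = d → σ (σ s) = s := fun {s d} hs => by
    rcases map_eq_or_eq_neg σ hs with h | h <;> simp [h]
  ext x
  obtain ⟨α, β, γ, δ, rfl⟩ := h.span x
  have k1 : σ (σ s₁) = s₁ := key (d := b * c) (by rw [h.sq₁]; push_cast; rfl)
  have k2 : σ (σ s₂) = s₂ := key (d := a * c) (by rw [h.sq₂]; push_cast; rfl)
  have k3 : σ (σ s₃) = s₃ := key (d := a * b) (by rw [h.sq₃]; push_cast; rfl)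
  simp [pow_two, k1, k2, k3]

end BiquadGen

section Character

variable {K : Type*} [Field K] [Algebra ℚ K] [FiniteDimensional ℚ K]

/-- Every quadratic character of the Galois group has a nonzero eigenvector. -/
lemma exists_eigenvector (χ : (K ≃ₐ[ℚ] K) →* ℤˣ) :
    ∃ s : K, s ≠ 0 ∧ ∀ σ : K ≃ₐ[ℚ] K, σ s = ((χ σ : ℤ) : K) * s := by
  have hli := (linearIndependent_monoidHom K K).comp
    (fun σ : K ≃ₐ[ℚ] K => ((σ : K →* K))) (fun σ τ h => by
      ext x
      exact DFunLike.congr_fun h x)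
  rw [Fintype.linearIndependent_iff] at hli
  have hx : ∃ x : K, ∑ σ : K ≃ₐ[ℚ] K, ((χ σ : ℤ) : K) * σ x ≠ 0 := by
    by_contra! hcon
    have := hli (fun σ => ((χ σ : ℤ) : K)) (by
      ext x
      simpa using hcon x) 1
    simp at this
  obtain ⟨x, hx⟩ := hx
  refine ⟨_, hx, fun τ => ?_⟩
  rw [map_sum, Finset.mul_sum]
  refine Fintype.sum_equiv (Equiv.mulLeft τ) _ _ fun σ => ?_
  have e : ((χ τ : ℤ) : K) * ((χ τ : ℤ) : K) = 1 := by
    rw [← Int.cast_mul, ← Units.val_mul, Int.units_mul_self]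
    simp
  simp only [map_mul, map_intCast, Equiv.coe_mulLeft, AlgEquiv.mul_apply, Units.val_mul,
    Int.cast_mul]
  linear_combination (-((χ σ : ℤ) : K) * τ (σ x)) * e

lemma Rat.exists_squarefree_mul_sq {q : ℚ} (hq : q ≠ 0) :
    ∃ (d : ℤ) (r : ℚ), Squarefree d ∧ r ≠ 0 ∧ q * r ^ 2 = d := by
  have hn : q.num.natAbs * q.den ≠ 0 :=
    Nat.mul_ne_zero (Int.natAbs_ne_zero.2 (Rat.num_ne_zero.2 hq)) q.den_nz
  obtain ⟨m, k, hm, hk, hmk, hsf⟩ := Nat.sq_mul_squarefree_of_pos (Nat.pos_of_ne_zero hn)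
  have hkQ : (k : ℚ) ≠ 0 := by exact_mod_cast hk.ne'
  have hden : (q.den : ℚ) ≠ 0 := by exact_mod_cast q.den_nz
  refine ⟨q.num.sign * m, q.den / k, ?_, div_ne_zero hden hkQ, ?_⟩
  · rw [← Int.squarefree_natAbs, Int.natAbs_mul, Int.natAbs_sign_of_ne_zero
      (Rat.num_ne_zero.2 hq)]
    simpa using hsf
  · have h1 : (q.num : ℚ) * q.den = q.num.sign * m * k ^ 2 := by
      have : q.num * q.den = q.num.sign * m * k ^ 2 := by
        have h2 : ((k ^ 2 * m : ℕ) : ℤ) = (q.num.natAbs * q.den : ℕ) := by rw [hmk]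
        have h3 := Int.sign_mul_natAbs q.num
        push_cast at h2 h3
        linear_combination -(q.den : ℤ) * h3 - q.num.sign * h2
      exact_mod_cast this
    have h2 : q * q.den = q.num := Rat.mul_den_eq_num q
    rw [div_pow, ← mul_div_assoc, div_eq_iff (pow_ne_zero 2 hkQ)]
    push_cast
    linear_combination (q.den : ℚ) * h2 + h1

lemma exists_sqrt_of_character [IsGalois ℚ K] {χ : (K ≃ₐ[ℚ] K) →* ℤˣ} (hχ : χ ≠ 1) :
    ∃ (d : ℤ) (s : K), Squarefree d ∧ d ≠ 1 ∧ s ^ 2 = d ∧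
      ∀ σ : K ≃ₐ[ℚ] K, σ s = ((χ σ : ℤ) : K) * s := by
  have : CharZero K := algebraRat.charZero K
  obtain ⟨s, hs0, hs⟩ := exists_eigenvector χ
  obtain ⟨q, hq⟩ := (IsGalois.mem_range_algebraMap_iff_fixed (s ^ 2)).2 (fun σ => by
    have e : ((χ σ : ℤ) : K) * ((χ σ : ℤ) : K) = 1 := by
      rw [← Int.cast_mul, ← Units.val_mul, Int.units_mul_self]
      simp
    rw [map_pow, hs σ]
    linear_combination s ^ 2 * e)
  rw [eq_ratCast] at hq
  have hq0 : q ≠ 0 := by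
    rintro rfl
    rw [Rat.cast_zero] at hq
    exact hs0 (pow_eq_zero_iff two_ne_zero |>.1 hq.symm)
  obtain ⟨d, r, hd, hr, hdr⟩ := Rat.exists_squarefree_mul_sq hq0
  have hr' : (r : K) ≠ 0 := by exact_mod_cast hr
  have hsq : (r * s) ^ 2 = d := by
    rw [mul_pow, ← hq]
    have : ((q * r ^ 2 : ℚ) : K) = ((d : ℚ) : K) := by rw [hdr]
    push_cast at this
    rw [← this]
    ring
  have hev : ∀ σ : K ≃ₐ[ℚ] K, σ (r * s) = ((χ σ : ℤ) : K) * (r * s) := fun σ => by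
    rw [map_mul, hs σ, map_ratCast]
    ring
  refine ⟨d, r * s, hd, ?_, hsq, hev⟩
  rintro rfl
  apply hχ
  ext σ
  have h1 : σ (r * s) = r * s := by
    rcases sq_eq_sq_iff_eq_or_eq_neg.1 (by rw [hsq]; simp : ((r : K) * s) ^ 2 = 1 ^ 2)
      with h | h <;> rw [h] <;> simp
  rw [hev σ] at h1
  have := mul_right_cancel₀ (mul_ne_zero hr' hs0) (h1.trans (one_mul _).symm)
  simpa using (by exact_mod_cast this : (χ σ : ℤ) = 1)

end Character

lemma isAlgebraic_algebraicClosure : Algebra.IsAlgebraic ℚ (AlgebraicClosure ℚ) :=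
  AlgebraicClosure.isAlgebraic ℚ

lemma normal_algebraicClosure : Normal ℚ (AlgebraicClosure ℚ) :=
  have := isAlgebraic_algebraicClosure
  normal_iff.2 fun x => ⟨Algebra.IsIntegral.isIntegral x, IsAlgClosed.splits _⟩

/-- The field `ℚ(√d, √e)` inside the algebraic closure. -/
noncomputable def sqrtField (d e : ℤ) : IntermediateField ℚ (AlgebraicClosure ℚ) :=
  IntermediateField.adjoin ℚ {x | x ^ 2 = (d : AlgebraicClosure ℚ) ∨ x ^ 2 = e}

lemma sqrtField_le {K : IntermediateField ℚ (AlgebraicClosure ℚ)} {d e : ℤ}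
    (hd : ∃ s : K, s ^ 2 = d) (he : ∃ t : K, t ^ 2 = e) : sqrtField d e ≤ K := by
  rw [sqrtField, IntermediateField.adjoin_le_iff]
  obtain ⟨s, hs⟩ := hd
  obtain ⟨t, ht⟩ := he
  have hs' : (s : AlgebraicClosure ℚ) ^ 2 = d := by exact_mod_cast congrArg Subtype.val hs
  have ht' : (t : AlgebraicClosure ℚ) ^ 2 = e := by exact_mod_cast congrArg Subtype.val ht
  rintro x (hx | hx)
  · rcases sq_eq_sq_iff_eq_or_eq_neg.1 (hx.trans hs'.symm) with rfl | rfl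
    · exact s.2
    · exact neg_mem s.2
  · rcases sq_eq_sq_iff_eq_or_eq_neg.1 (hx.trans ht'.symm) with rfl | rfl
    · exact t.2
    · exact neg_mem t.2

lemma exists_sq_eq_left (d e : ℤ) : ∃ s : sqrtField d e, s ^ 2 = d := by
  obtain ⟨s, hs⟩ := IsAlgClosed.exists_pow_nat_eq (d : AlgebraicClosure ℚ) (n := 2) (by norm_num)
  exact ⟨⟨s, IntermediateField.subset_adjoin _ _ (.inl hs)⟩, Subtype.ext (by simpa using hs)⟩

lemma exists_sq_eq_right (d e : ℤ) : ∃ s : sqrtField d e, s ^ 2 = e := by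
  obtain ⟨s, hs⟩ := IsAlgClosed.exists_pow_nat_eq (e : AlgebraicClosure ℚ) (n := 2) (by norm_num)
  exact ⟨⟨s, IntermediateField.subset_adjoin _ _ (.inr hs)⟩, Subtype.ext (by simpa using hs)⟩

lemma finite_setOf_sq_eq (d : ℤ) : {x : AlgebraicClosure ℚ | x ^ 2 = d}.Finite := by
  obtain ⟨s, hs⟩ := IsAlgClosed.exists_pow_nat_eq (d : AlgebraicClosure ℚ) (n := 2) (by norm_num)
  refine (Set.toFinite {s, -s}).subset fun x hx => ?_
  simpa using sq_eq_sq_iff_eq_or_eq_neg.1 (Eq.trans hx hs.symm)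

instance (d e : ℤ) : FiniteDimensional ℚ (sqrtField d e) := by
  have : Finite {x | x ^ 2 = (d : AlgebraicClosure ℚ) ∨ x ^ 2 = e} :=
    ((finite_setOf_sq_eq d).union (finite_setOf_sq_eq e)).to_subtype
  have := isAlgebraic_algebraicClosure
  exact IntermediateField.finiteDimensional_adjoin fun x _ =>
    (Algebra.IsAlgebraic.isAlgebraic x).isIntegral

instance (d e : ℤ) : IsGalois ℚ (sqrtField d e) := by
  have : Normal ℚ (sqrtField d e) := by
    have := normal_algebraicClosure
    refine IntermediateField.normal_iff_forall_map_le.2 fun σ => ?_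
    rw [sqrtField, IntermediateField.adjoin_map]
    refine IntermediateField.adjoin.mono _ _ _ ?_
    rintro _ ⟨x, hx, rfl⟩
    rcases hx with hx | hx
    · exact .inl (by rw [← map_pow, hx, map_intCast])
    · exact .inr (by rw [← map_pow, hx, map_intCast])
  exact ⟨⟩

lemma sqrtField_span {d e : ℤ} {s t : sqrtField d e} (hs : s ^ 2 = d) (ht : t ^ 2 = e)
    (x : sqrtField d e) : ∃ α β γ δ : ℚ, x = α + β * s + γ * t + δ * (s * t) := by
  have hs' : (s : AlgebraicClosure ℚ) ^ 2 = d := by exact_mod_cast congrArg Subtype.val hs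
  have ht' : (t : AlgebraicClosure ℚ) ^ 2 = e := by exact_mod_cast congrArg Subtype.val ht
  have key : ∀ y ∈ Algebra.adjoin ℚ {x | x ^ 2 = (d : AlgebraicClosure ℚ) ∨ x ^ 2 = e},
      ∃ α β γ δ : ℚ, y = α + β * (s : AlgebraicClosure ℚ) + γ * t + δ * (s * t) := by
    intro y hy
    induction hy using Algebra.adjoin_induction with
    | mem y hy =>
      rcases hy with hy | hy
      · rcases sq_eq_sq_iff_eq_or_eq_neg.1 (hy.trans hs'.symm) with rfl | rfl
        · exact ⟨0, 1, 0, 0, by simp⟩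
        · exact ⟨0, -1, 0, 0, by simp⟩
      · rcases sq_eq_sq_iff_eq_or_eq_neg.1 (hy.trans ht'.symm) with rfl | rfl
        · exact ⟨0, 0, 1, 0, by simp⟩
        · exact ⟨0, 0, -1, 0, by simp⟩
    | algebraMap r => exact ⟨r, 0, 0, 0, by simp⟩
    | add y z _ _ hy hz =>
      obtain ⟨α, β, γ, δ, rfl⟩ := hy
      obtain ⟨α', β', γ', δ', rfl⟩ := hz
      exact ⟨α + α', β + β', γ + γ', δ + δ', by push_cast; ring⟩
    | mul y z _ _ hy hz =>
      obtain ⟨α, β, γ, δ, rfl⟩ := hy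
      obtain ⟨α', β', γ', δ', rfl⟩ := hz
      refine ⟨α * α' + β * β' * d + γ * γ' * e + δ * δ' * (d * e),
        α * β' + β * α' + (γ * δ' + δ * γ') * e, α * γ' + γ * α' + (β * δ' + δ * β') * d,
        α * δ' + δ * α' + β * γ' + γ * β', ?_⟩
      push_cast
      rw [← hs', ← ht']
      ring
  have := isAlgebraic_algebraicClosure
  have hx : (x : AlgebraicClosure ℚ) ∈
      Algebra.adjoin ℚ {x | x ^ 2 = (d : AlgebraicClosure ℚ) ∨ x ^ 2 = e} := by
    rw [← IntermediateField.adjoin_toSubalgebra_of_isAlgebraic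
      (fun x _ => Algebra.IsAlgebraic.isAlgebraic x)]
    exact x.2
  obtain ⟨α, β, γ, δ, h⟩ := key _ hx
  refine ⟨α, β, γ, δ, Subtype.ext ?_⟩
  push_cast
  exact h

/-- The triples `(a, b, c)` parametrizing the ordered pairs `(bc, ac)` of distinct squarefree
integers different from `1`. -/
def IsBiquadTriple (x : ℤ × ℤ × ℤ) : Prop :=
  Squarefree (x.1 * x.2.1 * x.2.2) ∧ x.2.1 * x.2.2 ≠ 1 ∧ x.1 * x.2.2 ≠ 1 ∧ x.1 ≠ x.2.1 ∧ 0 < x.2.2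

/-- The field `ℚ(√(bc), √(ac))`. -/
noncomputable abbrev tripleField (x : ℤ × ℤ × ℤ) : IntermediateField ℚ (AlgebraicClosure ℚ) :=
  sqrtField (x.2.1 * x.2.2) (x.1 * x.2.2)

lemma IsBiquadTriple.exists_biquadGen {x : ℤ × ℤ × ℤ} (h : IsBiquadTriple x) :
    ∃ s₁ s₂ s₃ : tripleField x, BiquadGen (tripleField x) s₁ s₂ s₃ x.1 x.2.1 x.2.2 := by
  obtain ⟨h1, h2, h3, h4, h5⟩ := h
  obtain ⟨s, hs⟩ := exists_sq_eq_left (x.2.1 * x.2.2) (x.1 * x.2.2)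
  obtain ⟨t, ht⟩ := exists_sq_eq_right (x.2.1 * x.2.2) (x.1 * x.2.2)
  exact ⟨_, _, _, BiquadGen.of_isGalois h1 h2 h3 h4 h5 (by rw [hs]; push_cast; rfl)
    (by rw [ht]; push_cast; rfl) (sqrtField_span hs ht)⟩

lemma IsBiquadTriple.finrank_eq {x : ℤ × ℤ × ℤ} (h : IsBiquadTriple x) :
    Module.finrank ℚ (tripleField x) = 4 := by
  obtain ⟨_, _, _, h⟩ := h.exists_biquadGen
  exact h.finrank_eq

lemma IsBiquadTriple.isBiquadratic {x : ℤ × ℤ × ℤ} (h : IsBiquadTriple x) :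
    IsBiquadratic (tripleField x) := by
  obtain ⟨_, _, _, h⟩ := h.exists_biquadGen
  have i1 : FiniteDimensional ℚ (tripleField x) := by unfold tripleField; infer_instance
  have i2 : IsGalois ℚ (tripleField x) := by unfold tripleField; infer_instance
  have := h.isKleinFour
  exact ⟨i1, i2, IsKleinFour.nonempty_mulEquiv⟩

lemma IsBiquadTriple.biquadDiscr_eq {x : ℤ × ℤ × ℤ} (h : IsBiquadTriple x) :
    biquadDiscr (tripleField x) = (ramFactor x.1 x.2.1 x.2.2 * (x.1 * x.2.1 * x.2.2)) ^ 2 := by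
  obtain ⟨s₁, s₂, s₃, h⟩ := h.exists_biquadGen
  have i1 : FiniteDimensional ℚ (tripleField x) := by unfold tripleField; infer_instance
  have i2 : NumberField (tripleField x) := ⟨⟩
  rw [biquadDiscr, dif_pos i1]
  refine BiquadGen.discr_eq (s₁ := s₁) (s₂ := s₂) (s₃ := s₃) ?_
  convert h

lemma isBiquadTriple_of_ne {d e : ℤ} (hd : Squarefree d) (he : Squarefree e) (hd1 : d ≠ 1)
    (he1 : e ≠ 1) (hde : d ≠ e) :
    ∃ x, IsBiquadTriple x ∧ x.2.1 * x.2.2 = d ∧ x.1 * x.2.2 = e := by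
  have hg : 0 < Int.gcd d e := Int.gcd_pos_of_ne_zero_left _ hd.ne_zero
  obtain ⟨b, a, hcop, hb, ha⟩ := Int.exists_gcd_one hg
  have hsf : Squarefree (a * b * (Int.gcd d e : ℤ)) := by
    rw [mul_assoc, ← hb]
    rw [ha] at he
    refine squarefree_mul_iff.2 ⟨?_, he.squarefree_of_dvd (dvd_mul_right _ _), hd⟩
    rw [hb]
    refine IsRelPrime.mul_right ?_ (IsRelPrime.of_squarefree_mul he)
    exact (Int.isCoprime_iff_gcd_eq_one.2 (by rwa [Int.gcd_comm])).isRelPrime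
  refine ⟨(a, b, Int.gcd d e), ⟨hsf, by simpa [← hb], by simpa [← ha], ?_, by simpa using hg⟩,
    hb.symm, ha.symm⟩
  rintro (h : a = b)
  exact hde (hb.trans (by rw [← h]; exact ha.symm))

lemma IsBiquadratic.exists_triple {K : IntermediateField ℚ (AlgebraicClosure ℚ)}
    (hK : IsBiquadratic K) : ∃ x, IsBiquadTriple x ∧ tripleField x = K := by
  obtain ⟨i1, i2, ⟨φ⟩⟩ := hK
  have hK4 : Module.finrank ℚ K = 4 := by
    rw [← IsGalois.card_aut_eq_finrank, Nat.card_congr φ.toEquiv]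
    simp
  let χ₁ : Multiplicative (ZMod 2 × ZMod 2) →* ℤˣ :=
    { toFun := fun x => if x.toAdd.1 = 0 then 1 else -1
      map_one' := by decide
      map_mul' := by decide }
  let χ₂ : Multiplicative (ZMod 2 × ZMod 2) →* ℤˣ :=
    { toFun := fun x => if x.toAdd.2 = 0 then 1 else -1
      map_one' := by decide
      map_mul' := by decide }
  have h1 : χ₁.comp φ.toMonoidHom ≠ 1 := fun h => by
    have := DFunLike.congr_fun h (φ.symm (Multiplicative.ofAdd (1, 0)))
    simp [χ₁] at this
  have h2 : χ₂.comp φ.toMonoidHom ≠ 1 := fun h => by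
    have := DFunLike.congr_fun h (φ.symm (Multiplicative.ofAdd (0, 1)))
    simp [χ₂] at this
  obtain ⟨d, s, hd, hd1, hs, hsσ⟩ := exists_sqrt_of_character h1
  obtain ⟨e, t, he, he1, ht, htσ⟩ := exists_sqrt_of_character h2
  have hs0 : s ≠ 0 := by
    rintro rfl
    have : (d : K) = 0 := by rw [← hs]; simp
    exact hd.ne_zero (by exact_mod_cast this)
  have hde : d ≠ e := by
    rintro rfl
    have e1 := hsσ (φ.symm (Multiplicative.ofAdd (1, 0)))
    have e2 := htσ (φ.symm (Multiplicative.ofAdd (1, 0)))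
    have c1 : χ₁ (Multiplicative.ofAdd (1, 0)) = -1 := by decide
    have c2 : χ₂ (Multiplicative.ofAdd (1, 0)) = 1 := by decide
    simp [c1] at e1
    simp [c2] at e2
    rcases sq_eq_sq_iff_eq_or_eq_neg.1 (hs.trans ht.symm) with rfl | rfl
    · rw [e2] at e1
      exact hs0 (self_eq_neg.1 e1)
    · rw [map_neg, e2, neg_neg] at e1
      exact hs0 (by rw [← e1]; simpa using self_eq_neg.1 e1.symm)
  obtain ⟨x, hx, hxd, hxe⟩ := isBiquadTriple_of_ne hd he hd1 he1 hde
  refine ⟨x, hx, ?_⟩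
  refine IntermediateField.eq_of_le_of_finrank_eq ?_ (by rw [hx.finrank_eq, hK4])
  exact sqrtField_le ⟨s, by rw [hs, hxd]⟩ ⟨t, by rw [ht, hxe]⟩

lemma IsBiquadTriple.gcd_eq {x : ℤ × ℤ × ℤ} (h : IsBiquadTriple x) :
    (Int.gcd (x.2.1 * x.2.2) (x.1 * x.2.2) : ℤ) = x.2.2 := by
  obtain ⟨h1, -, -, -, h5⟩ := h
  have h1 : IsCoprime x.2.1 x.1 :=
    (IsRelPrime.of_squarefree_mul (h1.squarefree_of_dvd (dvd_mul_right _ _))).isCoprime.symm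
  rw [Int.gcd_mul_right, Int.isCoprime_iff_gcd_eq_one.1 h1, one_mul, Int.natCast_natAbs,
    abs_of_pos h5]

lemma IsBiquadTriple.eq_of_mul_eq {x y : ℤ × ℤ × ℤ} (hx : IsBiquadTriple x)
    (hy : IsBiquadTriple y) (h1 : x.2.1 * x.2.2 = y.2.1 * y.2.2) (h2 : x.1 * x.2.2 = y.1 * y.2.2) :
    x = y := by
  have hc : x.2.2 = y.2.2 := by rw [← hx.gcd_eq, ← hy.gcd_eq, h1, h2]
  have hc0 : y.2.2 ≠ 0 := hy.2.2.2.2.ne'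
  rw [hc] at h1 h2
  exact Prod.ext (mul_right_cancel₀ hc0 h2) (Prod.ext (mul_right_cancel₀ hc0 h1) hc)

/-- The three squarefree integers `bc, ac, ab` attached to the triple `(a, b, c)`. -/
def tripleProducts (x : ℤ × ℤ × ℤ) : Finset ℤ :=
  {x.2.1 * x.2.2, x.1 * x.2.2, x.1 * x.2.1}

lemma IsBiquadTriple.card_tripleProducts {x : ℤ × ℤ × ℤ} (h : IsBiquadTriple x) :
    (tripleProducts x).card = 3 := by
  obtain ⟨h1, h2, h3, h4, h5⟩ := h
  have key : ∀ u v w : ℤ, Squarefree (u * v * w) → 0 < w → v * w ≠ 1 → u * w ≠ 1 →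
      v * w ≠ u * v := fun u v w hsf hw h1 h2 he => by
    have hv : v ≠ 0 := fun h => hsf.ne_zero (by simp [h])
    have : w = u := mul_left_cancel₀ hv (by rw [he, mul_comm])
    subst this
    have := hsf w ⟨v, by ring⟩
    rcases Int.isUnit_iff.1 this with rfl | rfl
    · exact h2 rfl
    · exact h2 rfl
  refine Finset.card_eq_three.2 ⟨_, _, _, fun h => h4 ?_, key _ _ _ h1 h5 h2 h3, ?_, rfl⟩
  · exact (mul_right_cancel₀ h5.ne' h).symm
  · rw [mul_comm x.1 x.2.1]
    exact key _ _ _ (by rwa [mul_comm x.2.1]) h5 h3 h2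

lemma IsBiquadTriple.exists_sq_eq {x : ℤ × ℤ × ℤ} (h : IsBiquadTriple x) {d : ℤ}
    (hd : d ∈ tripleProducts x) :
    Squarefree d ∧ d ≠ 1 ∧ ∃ s : tripleField x, s ^ 2 = d := by
  obtain ⟨s₁, s₂, s₃, g⟩ := h.exists_biquadGen
  obtain ⟨h1, h2, h3, h4, h5⟩ := h
  simp only [tripleProducts, Finset.mem_insert, Finset.mem_singleton] at hd
  rcases hd with rfl | rfl | rfl
  · exact ⟨g.sf₁, h2, s₁, by rw [g.sq₁]; push_cast; rfl⟩
  · exact ⟨g.sf₂, h3, s₂, by rw [g.sq₂]; push_cast; rfl⟩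
  · refine ⟨g.sf₃, fun h => h4 ?_, s₃, by rw [g.sq₃]; push_cast; rfl⟩
    rcases Int.mul_eq_one_iff_eq_one_or_neg_one.1 h with ⟨e1, e2⟩ | ⟨e1, e2⟩ <;> rw [e1, e2]

lemma IsBiquadTriple.mem_tripleProducts {x : ℤ × ℤ × ℤ} (h : IsBiquadTriple x) {d : ℤ}
    (hd : Squarefree d) (hd1 : d ≠ 1) (hs : ∃ s : tripleField x, s ^ 2 = d) :
    d ∈ tripleProducts x := by
  obtain ⟨s₁, s₂, s₃, g⟩ := h.exists_biquadGen
  obtain ⟨s, hs⟩ := hs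
  simpa only [tripleProducts, Finset.mem_insert, Finset.mem_singleton] using g.eq_of_sq_eq hs hd hd1

/-- Each biquadratic field comes from six triples. -/
lemma IsBiquadTriple.ncard_fiber {x : ℤ × ℤ × ℤ} (hx : IsBiquadTriple x) :
    {y | IsBiquadTriple y ∧ tripleField y = tripleField x}.ncard = 6 := by
  have hbij : Set.BijOn (fun y : ℤ × ℤ × ℤ => (y.2.1 * y.2.2, y.1 * y.2.2))
      {y | IsBiquadTriple y ∧ tripleField y = tripleField x}
      ((tripleProducts x).offDiag : Set (ℤ × ℤ)) := by
    refine ⟨?_, ?_, ?_⟩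
    · rintro y ⟨hy, he⟩
      have hsub : ∀ d ∈ tripleProducts y, d ∈ tripleProducts x := fun d hd => by
        obtain ⟨k1, k2, k3⟩ := hy.exists_sq_eq hd
        exact hx.mem_tripleProducts k1 k2 (he ▸ k3)
      refine Finset.mem_coe.2 (Finset.mem_offDiag.2 ⟨hsub _ ?_, hsub _ ?_, ?_⟩)
      · simp [tripleProducts]
      · simp [tripleProducts]
      · exact fun h => hy.2.2.2.1 (mul_right_cancel₀ hy.2.2.2.2.ne' h).symm
    · rintro y ⟨hy, -⟩ z ⟨hz, -⟩ he
      exact hy.eq_of_mul_eq hz (congrArg Prod.fst he) (congrArg Prod.snd he)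
    · rintro ⟨d, e⟩ hde
      obtain ⟨hd, he, hne⟩ := Finset.mem_offDiag.1 (Finset.mem_coe.1 hde)
      obtain ⟨k1, k2, k3⟩ := hx.exists_sq_eq hd
      obtain ⟨l1, l2, l3⟩ := hx.exists_sq_eq he
      obtain ⟨y, hy, rfl, rfl⟩ := isBiquadTriple_of_ne k1 l1 k2 l2 hne
      refine ⟨y, ⟨hy, ?_⟩, rfl⟩
      exact IntermediateField.eq_of_le_of_finrank_eq (sqrtField_le k3 l3)
        (by rw [hx.finrank_eq]; exact hy.finrank_eq)
  rw [hbij.ncard_eq, Set.ncard_coe_finset, Finset.offDiag_card, hx.card_tripleProducts]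

/-- The square root of the discriminant of the field attached to the triple `(a, b, c)`. -/
def tripleHeight (x : ℤ × ℤ × ℤ) : ℤ :=
  ramFactor x.1 x.2.1 x.2.2 * |x.1 * x.2.1 * x.2.2|

lemma one_le_ramFactor (a b c : ℤ) : 1 ≤ ramFactor a b c := by
  unfold ramFactor
  split_ifs <;> norm_num

lemma tripleHeight_nonneg (x : ℤ × ℤ × ℤ) : 0 ≤ tripleHeight x := by
  unfold tripleHeight
  positivity

lemma finite_setOf_tripleHeight_le (Y : ℝ) :
    {x : ℤ × ℤ × ℤ | Squarefree (x.1 * x.2.1 * x.2.2) ∧ (tripleHeight x : ℝ) ≤ Y}.Finite := by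
  refine (Set.toFinite ((Finset.Icc (-⌊Y⌋) ⌊Y⌋ ×ˢ Finset.Icc (-⌊Y⌋) ⌊Y⌋ ×ˢ
    Finset.Icc (-⌊Y⌋) ⌊Y⌋ : Finset (ℤ × ℤ × ℤ)) : Set (ℤ × ℤ × ℤ))).subset ?_
  rintro ⟨a, b, c⟩ ⟨h1, h2⟩
  have h0 := h1.ne_zero
  have hY : |a * b * c| ≤ ⌊Y⌋ := by
    refine le_trans ?_ (Int.le_floor.2 h2)
    exact le_mul_of_one_le_left (abs_nonneg _) (by exact_mod_cast one_le_ramFactor a b c)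
  have key : ∀ d, d ∣ a * b * c → -⌊Y⌋ ≤ d ∧ d ≤ ⌊Y⌋ := fun d hd =>
    abs_le.1 ((Int.le_of_dvd (abs_pos.2 h0) ((abs_dvd_abs _ _).2 hd)).trans hY)
  simp only [Finset.coe_product, Finset.coe_Icc, Set.mem_prod, Set.mem_Icc]
  exact ⟨key a ⟨b * c, by ring⟩, key b ⟨a * c, by ring⟩, key c ⟨a * b, by ring⟩⟩

lemma IsBiquadTriple.biquadDiscr_le_iff {x : ℤ × ℤ × ℤ} (hx : IsBiquadTriple x) {X : ℝ}
    (hX : 0 ≤ X) : (biquadDiscr (tripleField x) : ℝ) ≤ X ↔ (tripleHeight x : ℝ) ≤ √X := by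
  rw [Real.le_sqrt (by exact_mod_cast tripleHeight_nonneg x) hX, hx.biquadDiscr_eq, tripleHeight]
  push_cast
  rw [mul_pow _ |_|, sq_abs, mul_pow]

/-- Counting biquadratic fields by counting triples. -/
lemma six_mul_biquadCount {X : ℝ} (hX : 0 ≤ X) :
    6 * biquadCount X = {x | IsBiquadTriple x ∧ (tripleHeight x : ℝ) ≤ √X}.ncard := by
  have hfin : {x | IsBiquadTriple x ∧ (tripleHeight x : ℝ) ≤ √X}.Finite :=
    (finite_setOf_tripleHeight_le √X).subset fun x hx => ⟨hx.1.1, hx.2⟩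
  have himg : {K : IntermediateField ℚ (AlgebraicClosure ℚ) |
      IsBiquadratic K ∧ (biquadDiscr K : ℝ) ≤ X} =
      tripleField '' {x | IsBiquadTriple x ∧ (tripleHeight x : ℝ) ≤ √X} := by
    ext K
    constructor
    · rintro ⟨hK, hd⟩
      obtain ⟨x, hx, rfl⟩ := hK.exists_triple
      exact ⟨x, ⟨hx, (hx.biquadDiscr_le_iff hX).1 hd⟩, rfl⟩
    · rintro ⟨x, ⟨hx, hd⟩, rfl⟩
      exact ⟨hx.isBiquadratic, (hx.biquadDiscr_le_iff hX).2 hd⟩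
  rw [biquadCount, himg]
  have hco : tripleField '' {x | IsBiquadTriple x ∧ (tripleHeight x : ℝ) ≤ √X} =
      (hfin.toFinset.image tripleField : Set _) := by simp
  rw [hco, Set.ncard_coe_finset, Set.ncard_eq_toFinset_card _ hfin,
    Finset.card_eq_sum_card_fiberwise (f := tripleField) (t := hfin.toFinset.image tripleField)
      (fun x hx => Finset.mem_coe.2 (Finset.mem_image_of_mem _ hx)),
    Finset.sum_const_nat (m := 6), mul_comm]
  intro K hK
  obtain ⟨x, hx, rfl⟩ := Finset.mem_image.1 hK
  have hx := hfin.mem_toFinset.1 hx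
  rw [← hx.1.ncard_fiber, ← Set.ncard_coe_finset]
  congr 1
  ext y
  simp only [Finset.coe_filter, Set.Finite.mem_toFinset, Set.mem_ofPred_eq]
  refine ⟨fun h => ⟨h.1.1, h.2⟩, fun h => ⟨⟨h.1, ?_⟩, h.2⟩⟩
  rw [← h.1.biquadDiscr_le_iff hX, h.2, hx.1.biquadDiscr_le_iff hX]
  exact hx.2

lemma ramFactor_emod (a b c : ℤ) : ramFactor a b c = ramFactor (a % 4) (b % 4) (c % 4) := by
  simp only [ramFactor, ← Int.mul_emod]

/-- The triple with odd parts `o`, signs `i.1, i.2.1` and even entry specified by `i.2.2`. -/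
def signedTriple (o : Fin 3 → ℕ) (i : ℤˣ × ℤˣ × Fin 4) : ℤ × ℤ × ℤ :=
  (i.1 * o 0 * (if i.2.2 = 1 then 2 else 1), i.2.1 * o 1 * (if i.2.2 = 2 then 2 else 1),
    o 2 * (if i.2.2 = 3 then 2 else 1))

/-- The ratio between the height of a triple and the product of the odd parts of its entries. -/
def tripleWeight (a b c : ℤ) (i : ℤˣ × ℤˣ × Fin 4) : ℕ :=
  ramFactor (i.1 * a * (if i.2.2 = 1 then 2 else 1)) (i.2.1 * b * (if i.2.2 = 2 then 2 else 1))
    (c * (if i.2.2 = 3 then 2 else 1)) * (if i.2.2 = 0 then 1 else 2)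

lemma tripleWeight_emod (a b c : ℤ) (i : ℤˣ × ℤˣ × Fin 4) :
    tripleWeight a b c i = tripleWeight (a % 4) (b % 4) (c % 4) i := by
  rw [tripleWeight, tripleWeight, ramFactor_emod]
  conv_rhs => rw [ramFactor_emod]
  simp only [Int.mul_emod, Int.emod_emod]

lemma map_tripleWeight {a b c : ℤ} (ha : Odd a) (hb : Odd b) (hc : Odd c) :
    (Finset.univ.val.map (tripleWeight a b c)) =
      Multiset.replicate 1 1 + Multiset.replicate 3 4 + Multiset.replicate 6 8
        + Multiset.replicate 6 16 := by
  rw [funext (tripleWeight_emod a b c)]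
  have key : ∀ n : ℤ, Odd n → n % 4 = 1 ∨ n % 4 = 3 := fun n hn => by
    have := Int.odd_iff.1 hn
    omega
  rcases key a ha with ha | ha <;> rcases key b hb with hb | hb <;>
    rcases key c hc with hc | hc <;> rw [ha, hb, hc] <;> decide

lemma sum_tripleWeight {a b c : ℤ} (ha : Odd a) (hb : Odd b) (hc : Odd c) (F : ℕ → ℝ) :
    ∑ i, F (tripleWeight a b c i) = F 1 + 3 * F 4 + 6 * F 8 + 6 * F 16 := by
  have := congrArg (fun m => (m.map F).sum) (map_tripleWeight ha hb hc)
  simp only [Multiset.map_map, Multiset.map_add, Multiset.map_replicate, Multiset.sum_add,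
    Multiset.sum_replicate] at this
  rw [Finset.sum_eq_multiset_sum]
  refine this.trans ?_
  simp

lemma signedTriple_prod (o : Fin 3 → ℕ) (i : ℤˣ × ℤˣ × Fin 4) :
    |(signedTriple o i).1 * (signedTriple o i).2.1 * (signedTriple o i).2.2| =
      ((if i.2.2 = 0 then 1 else 2) * ∏ j, o j : ℕ) := by
  obtain ⟨s, t, l⟩ := i
  have key : (signedTriple o (s, t, l)).1 * (signedTriple o (s, t, l)).2.1 *
      (signedTriple o (s, t, l)).2.2 =
      s * (t * ((if l = 0 then 1 else 2) * ∏ j, o j : ℕ)) := by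
    fin_cases l <;> simp [signedTriple, Fin.prod_univ_three] <;> ring
  rw [key, abs_mul, abs_mul, Int.isUnit_iff_abs_eq.1 s.isUnit, Int.isUnit_iff_abs_eq.1 t.isUnit,
    one_mul, one_mul, Nat.abs_cast]

lemma tripleHeight_signedTriple (o : Fin 3 → ℕ) (i : ℤˣ × ℤˣ × Fin 4) :
    tripleHeight (signedTriple o i) = (tripleWeight (o 0) (o 1) (o 2) i * ∏ j, o j : ℕ) := by
  rw [tripleHeight, signedTriple_prod, tripleWeight]
  push_cast [signedTriple]
  ring

lemma squarefree_signedTriple {o : Fin 3 → ℕ} (ho : Odd (∏ j, o j)) (i : ℤˣ × ℤˣ × Fin 4) :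
    Squarefree ((signedTriple o i).1 * (signedTriple o i).2.1 * (signedTriple o i).2.2) ↔
      Squarefree (∏ j, o j) := by
  rw [← Int.squarefree_natAbs, ← Int.natAbs_abs, signedTriple_prod, Int.natAbs_natCast]
  split_ifs
  · rw [one_mul]
  · rw [Nat.squarefree_mul_iff]
    exact ⟨fun h => h.2.2, fun h => ⟨Nat.coprime_two_left.2 ho, Nat.prime_two.squarefree, h⟩⟩

lemma eq_of_signed_mul_eq {s s' : ℤˣ} {m m' : ℕ} {e e' : ℤ} (hm : Odd m) (hm' : Odd m')
    (he : e = 1 ∨ e = 2) (he' : e' = 1 ∨ e' = 2) (h : (s : ℤ) * m * e = s' * m' * e') :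
    s = s' ∧ m = m' ∧ e = e' := by
  have h1 := Nat.odd_iff.1 hm
  have h2 := Nat.odd_iff.1 hm'
  rcases Int.units_eq_one_or s with rfl | rfl <;> rcases Int.units_eq_one_or s' with rfl | rfl <;>
    rcases he with rfl | rfl <;> rcases he' with rfl | rfl <;>
    push_cast at h <;> first | (refine ⟨rfl, ?_, rfl⟩; omega) | (exfalso; omega)

lemma signedTriple_injective {o o' : Fin 3 → ℕ} {i i' : ℤˣ × ℤˣ × Fin 4} (ho : ∀ j, Odd (o j))
    (ho' : ∀ j, Odd (o' j)) (h : signedTriple o i = signedTriple o' i') : o = o' ∧ i = i' := by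
  obtain ⟨s, t, l⟩ := i
  obtain ⟨s', t', l'⟩ := i'
  simp only [signedTriple, Prod.mk.injEq] at h
  obtain ⟨h0, h1, h2⟩ := h
  have he : ∀ k l : Fin 4,
      (if l = k then (2 : ℤ) else 1) = 1 ∨ (if l = k then (2 : ℤ) else 1) = 2 :=
    by decide
  obtain ⟨rfl, e0, f0⟩ := eq_of_signed_mul_eq (ho 0) (ho' 0) (he _ _) (he _ _) h0
  obtain ⟨rfl, e1, f1⟩ := eq_of_signed_mul_eq (ho 1) (ho' 1) (he _ _) (he _ _) h1
  obtain ⟨-, e2, f2⟩ := eq_of_signed_mul_eq (s := 1) (s' := 1) (ho 2) (ho' 2) (he _ _) (he _ _)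
    (by simpa using h2)
  have hl : l = l' := by
    revert f0 f1 f2
    clear * -
    revert l l'
    decide
  refine ⟨funext fun j => ?_, by rw [hl]⟩
  fin_cases j
  exacts [e0, e1, e2]

lemma exists_signedTriple {x : ℤ × ℤ × ℤ} (hx : Squarefree (x.1 * x.2.1 * x.2.2))
    (hc : 0 < x.2.2) : ∃ o i, (∀ j, Odd (o j)) ∧ signedTriple o i = x := by
  obtain ⟨a, b, c⟩ := x
  simp only at hx hc
  have key : ∀ u v w : ℤ, u * v * w = a * b * c → 2 ∣ u → 2 ∣ v → False := by
    intro u v w h hu hv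
    have := hx 2 (by rw [← h]; exact (mul_dvd_mul hu hv).mul_right w)
    exact absurd (Int.isUnit_iff.1 this) (by decide)
  have odd_of : ∀ n : ℤ, ¬ 2 ∣ n → ∃ (s : ℤˣ) (m : ℕ), Odd m ∧ (s : ℤ) * m = n ∧
      (0 < n → s = 1) := by
    intro n hn
    rcases Int.natAbs_eq n with h | h
    · exact ⟨1, n.natAbs, Nat.odd_iff.2 (by omega), by simpa using h.symm, fun _ => rfl⟩
    · exact ⟨-1, n.natAbs, Nat.odd_iff.2 (by omega), by simpa using h.symm, fun _ => by omega⟩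
  have half : ∀ n : ℤ, ¬ 4 ∣ n → 2 ∣ n → ∃ (s : ℤˣ) (m : ℕ), Odd m ∧ (s : ℤ) * m * 2 = n ∧
      (0 < n → s = 1) := by
    rintro n hn ⟨k, rfl⟩
    obtain ⟨s, m, h1, h2, h3⟩ := odd_of k (by omega)
    exact ⟨s, m, h1, by rw [h2, mul_comm], fun h => h3 (by omega)⟩
  have four : ∀ n : ℤ, n ∣ a * b * c → ¬ 4 ∣ n := fun n hn h => by
    have := hx 2 ((show (2 * 2 : ℤ) ∣ 4 by norm_num).trans (h.trans hn))
    exact absurd (Int.isUnit_iff.1 this) (by decide)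
  have build : ∀ (m₀ m₁ m₂ : ℕ), Odd m₀ → Odd m₁ → Odd m₂ → ∀ j : Fin 3, Odd (![m₀, m₁, m₂] j) := by
    intro m₀ m₁ m₂ h0 h1 h2 j
    fin_cases j
    exacts [h0, h1, h2]
  by_cases ha : 2 ∣ a
  · obtain ⟨s, m₀, h0, rfl, -⟩ := half a (four a ⟨b * c, by ring⟩) ha
    obtain ⟨t, m₁, h1, rfl, -⟩ := odd_of b fun hb => key _ _ _ rfl ha hb
    obtain ⟨r, m₂, h2, rfl, hr⟩ := odd_of c fun hc => key _ c (t * m₁) (by ring) ha hc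
    obtain rfl := hr hc
    exact ⟨_, (s, t, 1), build _ _ _ h0 h1 h2, by simp [signedTriple]⟩
  obtain ⟨s, m₀, h0, rfl, -⟩ := odd_of a ha
  by_cases hb : 2 ∣ b
  · obtain ⟨t, m₁, h1, rfl, -⟩ := half b (four b ⟨s * m₀ * c, by ring⟩) hb
    obtain ⟨r, m₂, h2, rfl, hr⟩ := odd_of c fun hc => key _ c (s * m₀) (by ring) hb hc
    obtain rfl := hr hc
    exact ⟨_, (s, t, 2), build _ _ _ h0 h1 h2, by simp [signedTriple]⟩
  obtain ⟨t, m₁, h1, rfl, -⟩ := odd_of b hb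
  by_cases hc2 : 2 ∣ c
  · obtain ⟨r, m₂, h2, rfl, hr⟩ := half c (four c ⟨s * m₀ * (t * m₁), by ring⟩) hc2
    obtain rfl := hr hc
    exact ⟨_, (s, t, 3), build _ _ _ h0 h1 h2, by simp [signedTriple]⟩
  · obtain ⟨r, m₂, h2, rfl, hr⟩ := odd_of c hc2
    obtain rfl := hr hc
    exact ⟨_, (s, t, 0), build _ _ _ h0 h1 h2, by simp [signedTriple]⟩

/-- The triples with squarefree product, third entry positive, and height at most `Y`. -/
def boundedTriples (Y : ℝ) : Set (ℤ × ℤ × ℤ) :=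
  {x | Squarefree (x.1 * x.2.1 * x.2.2) ∧ 0 < x.2.2 ∧ (tripleHeight x : ℝ) ≤ Y}

lemma summatory_div {f : ArithmeticFunction ℝ} {Y : ℝ} (hY : 0 ≤ Y) {k : ℕ} (hk : 0 < k) :
    summatory f (Y / k) = ∑ n ∈ Finset.Ioc 0 ⌊Y⌋₊, if ((k * n : ℕ) : ℝ) ≤ Y then f n else 0 := by
  have hk' : (0 : ℝ) < k := by exact_mod_cast hk
  rw [summatory, ← Finset.sum_filter]
  refine Finset.sum_congr ?_ fun _ _ => rfl
  ext n
  simp only [Finset.mem_Ioc, Finset.mem_filter, Nat.le_floor_iff hY,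
    Nat.le_floor_iff (div_nonneg hY hk'.le), le_div_iff₀ hk']
  have hn : (n : ℝ) ≤ k * n := le_mul_of_one_le_left (Nat.cast_nonneg n) (by exact_mod_cast hk)
  push_cast
  rw [mul_comm (n : ℝ)]
  exact ⟨fun h => ⟨⟨h.1, hn.trans h.2⟩, h.2⟩, fun h => ⟨h.1.1, h.2⟩⟩

lemma odd_of_mem_finMulAntidiag {n : ℕ} (hn : Odd n) {o : Fin 3 → ℕ}
    (ho : o ∈ Nat.finMulAntidiag 3 n) (j : Fin 3) : Odd (o j) :=
  Odd.of_dvd_nat hn (Nat.dvd_of_mem_finMulAntidiag ho j)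

lemma one_le_tripleWeight (a b c : ℤ) (i : ℤˣ × ℤˣ × Fin 4) : 1 ≤ tripleWeight a b c i :=
  Nat.mul_pos (one_le_ramFactor _ _ _) (by split_ifs <;> norm_num)

lemma ncard_boundedTriples {Y : ℝ} (hY : 0 ≤ Y) :
    ((boundedTriples Y).ncard : ℝ) = summatory oddTriple Y + 3 * summatory oddTriple (Y / 4)
      + 6 * summatory oddTriple (Y / 8) + 6 * summatory oddTriple (Y / 16) := by
  let D := (Finset.Ioc 0 ⌊Y⌋₊).filter fun n => Odd n ∧ Squarefree n
  let P : Finset ((Σ _ : ℕ, Fin 3 → ℕ) × ℤˣ × ℤˣ × Fin 4) :=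
    ((D.sigma fun n => Nat.finMulAntidiag 3 n) ×ˢ Finset.univ).filter fun q =>
      ((tripleWeight (q.1.2 0) (q.1.2 1) (q.1.2 2) q.2 * q.1.1 : ℕ) : ℝ) ≤ Y
  have hP : ∀ q, q ∈ P ↔ (Odd q.1.1 ∧ Squarefree q.1.1 ∧ q.1.2 ∈ Nat.finMulAntidiag 3 q.1.1) ∧
      ((tripleWeight (q.1.2 0) (q.1.2 1) (q.1.2 2) q.2 * q.1.1 : ℕ) : ℝ) ≤ Y := by
    intro q
    simp only [P, D, Finset.mem_filter, Finset.mem_product, Finset.mem_sigma, Finset.mem_univ,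
      and_true, Finset.mem_Ioc]
    refine ⟨fun h => ⟨⟨h.1.1.2.1, h.1.1.2.2, h.1.2⟩, h.2⟩, fun h =>
      ⟨⟨⟨⟨h.1.1.pos, Nat.le_floor (le_trans ?_ h.2)⟩, h.1.1, h.1.2.1⟩, h.1.2.2⟩, h.2⟩⟩
    exact_mod_cast Nat.le_mul_of_pos_left _ (one_le_tripleWeight _ _ _ _)
  have hbij : Set.BijOn (fun q : (Σ _ : ℕ, Fin 3 → ℕ) × ℤˣ × ℤˣ × Fin 4 => signedTriple q.1.2 q.2)
      (P : Set _) (boundedTriples Y) := by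
    refine ⟨?_, ?_, ?_⟩
    · rintro q hq
      obtain ⟨⟨h1, h2, h3⟩, h4⟩ := (hP q).1 hq
      have h5 := Nat.prod_eq_of_mem_finMulAntidiag h3
      refine ⟨(squarefree_signedTriple (by rwa [h5]) _).2 (by rwa [h5]), ?_, ?_⟩
      · have := (odd_of_mem_finMulAntidiag h1 h3 2).pos
        simp only [signedTriple]
        split_ifs <;> positivity
      · rw [tripleHeight_signedTriple, h5]
        exact_mod_cast h4
    · rintro ⟨⟨n, o⟩, i⟩ hq ⟨⟨n', o'⟩, i'⟩ hq' h
      obtain ⟨⟨h1, -, h3⟩, -⟩ := (hP _).1 hq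
      obtain ⟨⟨h1', -, h3'⟩, -⟩ := (hP _).1 hq'
      obtain ⟨rfl, rfl⟩ := signedTriple_injective (odd_of_mem_finMulAntidiag h1 h3)
        (odd_of_mem_finMulAntidiag h1' h3') h
      obtain rfl : n = n' :=
        (Nat.prod_eq_of_mem_finMulAntidiag h3).symm.trans (Nat.prod_eq_of_mem_finMulAntidiag h3')
      rfl
    · rintro x ⟨h1, h2, h3⟩
      obtain ⟨o, i, ho, rfl⟩ := exists_signedTriple h1 h2
      have hodd : Odd (∏ j, o j) := by
        rw [Fin.prod_univ_three]
        exact ((ho 0).mul (ho 1)).mul (ho 2)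
      refine ⟨(⟨∏ j, o j, o⟩, i), (hP _).2 ⟨⟨hodd, (squarefree_signedTriple hodd i).1 h1, ?_⟩, ?_⟩,
        rfl⟩
      · exact Nat.mem_finMulAntidiag.2 ⟨rfl, hodd.pos.ne'⟩
      · rw [tripleHeight_signedTriple] at h3
        exact_mod_cast h3
  rw [← hbij.ncard_eq, Set.ncard_coe_finset, Finset.card_filter, Finset.sum_product,
    Finset.sum_sigma]
  have hY1 := summatory_div (f := oddTriple) hY (k := 1) one_pos
  have hY4 := summatory_div (f := oddTriple) hY (k := 4) (by norm_num)
  have hY8 := summatory_div (f := oddTriple) hY (k := 8) (by norm_num)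
  have hY16 := summatory_div (f := oddTriple) hY (k := 16) (by norm_num)
  rw [Nat.cast_one, div_one] at hY1
  rw [Nat.cast_ofNat] at hY4 hY8 hY16
  rw [hY1, hY4, hY8, hY16, Finset.mul_sum, Finset.mul_sum, Finset.mul_sum,
    ← Finset.sum_add_distrib, ← Finset.sum_add_distrib, ← Finset.sum_add_distrib, Nat.cast_sum,
    Finset.sum_filter]
  refine Finset.sum_congr rfl fun n _ => ?_
  rw [oddTriple_apply]
  by_cases hn : Odd n ∧ Squarefree n
  · simp only [if_pos hn]
    have hinner : ∀ o ∈ Nat.finMulAntidiag 3 n,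
        ∑ i, (if ((tripleWeight (o 0) (o 1) (o 2) i * n : ℕ) : ℝ) ≤ Y then (1 : ℝ) else 0) =
        (if ((1 * n : ℕ) : ℝ) ≤ Y then (1 : ℝ) else 0)
          + 3 * (if ((4 * n : ℕ) : ℝ) ≤ Y then (1 : ℝ) else 0)
          + 6 * (if ((8 * n : ℕ) : ℝ) ≤ Y then (1 : ℝ) else 0)
          + 6 * (if ((16 * n : ℕ) : ℝ) ≤ Y then (1 : ℝ) else 0) := fun o ho => by
      have h := fun j => (odd_of_mem_finMulAntidiag hn.1 ho j)
      exact sum_tripleWeight ((Int.odd_coe_nat _).2 (h 0)) ((Int.odd_coe_nat _).2 (h 1))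
        ((Int.odd_coe_nat _).2 (h 2)) (fun w => if ((w * n : ℕ) : ℝ) ≤ Y then (1 : ℝ) else 0)
    simp only [Nat.cast_sum, Nat.cast_ite, Nat.cast_one, Nat.cast_zero]
    rw [Finset.sum_congr rfl hinner, Finset.sum_const, Nat.card_finMulAntidiag_of_squarefree hn.2,
      nsmul_eq_mul, Nat.cast_pow, Nat.cast_ofNat]
    split_ifs <;> ring
  · simp [if_neg hn]

lemma ncard_boundedTriples_sub_le {Y : ℝ} (hY : 0 ≤ Y) :
    ((boundedTriples Y).ncard : ℝ) ≤
      ({x | IsBiquadTriple x ∧ (tripleHeight x : ℝ) ≤ Y}.ncard : ℝ) + 4 * (2 * Y + 1) := by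
  let I : Finset ℤ := Finset.Icc (-⌊Y⌋) ⌊Y⌋
  let E : Finset (ℤ × ℤ × ℤ) := (I.image fun n => (n, 1, 1)) ∪ (I.image fun n => (1, n, 1)) ∪
    (I.image fun n => (1, 1, n)) ∪ (I.image fun n => (-1, -1, n))
  have hI : (I.card : ℝ) ≤ 2 * Y + 1 := by
    have h : ((⌊Y⌋ + 1 - -⌊Y⌋).toNat : ℤ) = 2 * ⌊Y⌋ + 1 := by
      have := Int.floor_nonneg.2 hY
      omega
    have h' : (I.card : ℝ) = 2 * ⌊Y⌋ + 1 := by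
      rw [Int.card_Icc]
      exact_mod_cast h
    rw [h']
    linarith [Int.floor_le Y]
  have hE : (E.card : ℝ) ≤ 4 * (2 * Y + 1) := by
    have : E.card ≤ I.card + I.card + I.card + I.card :=
      (Finset.card_union_le _ _).trans (add_le_add ((Finset.card_union_le _ _).trans (add_le_add
        ((Finset.card_union_le _ _).trans (add_le_add Finset.card_image_le Finset.card_image_le))
          Finset.card_image_le)) Finset.card_image_le)
    have : (E.card : ℝ) ≤ I.card + I.card + I.card + I.card := by exact_mod_cast this
    linarith
  have hsub : boundedTriples Y ⊆
      {x | IsBiquadTriple x ∧ (tripleHeight x : ℝ) ≤ Y} ∪ (E : Set (ℤ × ℤ × ℤ)) := by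
    rintro ⟨a, b, c⟩ ⟨h1, h2, h3⟩
    have hI : ∀ n, n ∣ a * b * c → n ∈ I := fun n hn => by
      refine Finset.mem_Icc.2 (abs_le.1 ?_)
      refine (Int.le_of_dvd (abs_pos.2 h1.ne_zero) ((abs_dvd_abs _ _).2 hn)).trans ?_
      refine le_trans ?_ (Int.le_floor.2 h3)
      exact le_mul_of_one_le_left (abs_nonneg _) (by exact_mod_cast one_le_ramFactor a b c)
    simp only at h1 h2
    rw [Set.mem_union, or_iff_not_imp_left]
    intro hn
    have hdeg : b * c = 1 ∨ a * c = 1 ∨ a = b := by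
      by_contra! h
      exact hn ⟨⟨h1, h.1, h.2.1, h.2.2, h2⟩, h3⟩
    simp only [E, Finset.coe_union, Finset.coe_image, Set.mem_union, Set.mem_image,
      Finset.mem_coe]
    rcases hdeg with h | h | rfl
    · rcases Int.mul_eq_one_iff_eq_one_or_neg_one.1 h with ⟨rfl, rfl⟩ | ⟨rfl, rfl⟩
      · exact .inl (.inl (.inl ⟨a, hI a ⟨1, by ring⟩, rfl⟩))
      · omega
    · rcases Int.mul_eq_one_iff_eq_one_or_neg_one.1 h with ⟨rfl, rfl⟩ | ⟨rfl, rfl⟩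
      · exact .inl (.inl (.inr ⟨b, hI b ⟨1, by ring⟩, rfl⟩))
      · omega
    · rcases Int.isUnit_iff.1 (h1 a (dvd_mul_right _ _)) with rfl | rfl
      · exact .inl (.inr ⟨c, hI c ⟨1, by ring⟩, rfl⟩)
      · exact .inr ⟨c, hI c ⟨1, by ring⟩, rfl⟩
  have hfin : {x | IsBiquadTriple x ∧ (tripleHeight x : ℝ) ≤ Y}.Finite :=
    (finite_setOf_tripleHeight_le Y).subset fun x hx => ⟨hx.1.1, hx.2⟩
  have := (Set.ncard_le_ncard hsub (hfin.union E.finite_toSet)).trans (Set.ncard_union_le _ _)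
  rw [Set.ncard_coe_finset] at this
  have : ((boundedTriples Y).ncard : ℝ) ≤
      ({x | IsBiquadTriple x ∧ (tripleHeight x : ℝ) ≤ Y}.ncard : ℝ) + E.card := by
    exact_mod_cast this
  linarith

lemma ncard_le_ncard_boundedTriples (Y : ℝ) :
    {x | IsBiquadTriple x ∧ (tripleHeight x : ℝ) ≤ Y}.ncard ≤ (boundedTriples Y).ncard :=
  Set.ncard_le_ncard (fun _ hx => ⟨hx.1.1, hx.1.2.2.2.2, hx.2⟩)
    ((finite_setOf_tripleHeight_le Y).subset fun _ hx => ⟨hx.1, hx.2.2⟩)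

lemma summatory_oddTriple_div {k : ℝ} (hk : 1 ≤ k) : ∃ B, ∀ y, k ≤ y →
    |summatory oddTriple (y / k) -
      (∏' p : Nat.Primes, (1 - 1 / (p : ℝ)) ^ 3 * (1 + 3 / (p : ℝ))) / 5
      * (y / k) * Real.log y ^ 2| ≤ B * (y * (1 + Real.log y)) := by
  obtain ⟨B, hB⟩ := summatory_oddTriple
  set P := (∏' p : Nat.Primes, (1 - 1 / (p : ℝ)) ^ 3 * (1 + 3 / (p : ℝ))) / 5
  have hk0 : 0 < k := by linarith
  have hlk := Real.log_nonneg hk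
  refine ⟨|B| + |P| * (2 * Real.log k + Real.log k ^ 2), fun y hy => ?_⟩
  have hy0 : 0 < y := by linarith
  have hly := Real.log_nonneg (hk.trans hy)
  have h1 := hB (y / k) ((one_le_div hk0).2 hy)
  have hyk : y / k ≤ y := div_le_self hy0.le hk
  rw [Real.log_div hy0.ne' hk0.ne'] at h1
  have e : summatory oddTriple (y / k) - P * (y / k) * Real.log y ^ 2 =
      (summatory oddTriple (y / k) - P * (y / k) * (Real.log y - Real.log k) ^ 2) +
        P * ((y / k) * (Real.log k ^ 2 - 2 * Real.log k * Real.log y)) := by ring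
  rw [e]
  refine (abs_add_le _ _).trans ?_
  rw [add_mul]
  refine add_le_add (h1.trans ?_) ?_
  · rw [mul_assoc]
    have hll : 0 ≤ Real.log y - Real.log k := sub_nonneg.2 (Real.log_le_log hk0 hy)
    gcongr
    · exact le_abs_self B
    · linarith
  · rw [abs_mul, abs_mul, abs_of_nonneg (by positivity : 0 ≤ y / k), mul_assoc |P| (_ + _)]
    refine mul_le_mul_of_nonneg_left ?_ (abs_nonneg _)
    have h2 : |Real.log k ^ 2 - 2 * Real.log k * Real.log y| ≤
        (2 * Real.log k + Real.log k ^ 2) * (1 + Real.log y) := by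
      rw [abs_le]
      constructor <;> nlinarith [mul_nonneg hlk hly, mul_nonneg (sq_nonneg (Real.log k)) hly,
        sq_nonneg (Real.log k)]
    calc y / k * |Real.log k ^ 2 - 2 * Real.log k * Real.log y|
        ≤ y * ((2 * Real.log k + Real.log k ^ 2) * (1 + Real.log y)) := by gcongr
      _ = _ := by ring

/-- `S(X) = (23/960) √X (log X)² ∏_p (1-1/p)³(1+3/p) + O(√X log X)`. -/
theorem stmt_0 :
    (fun X : ℝ =>
        (biquadCount X : ℝ)
          - 23 / 960 * Real.sqrt X * Real.log X ^ 2
            * ∏' p : Nat.Primes, (1 - 1 / (p : ℝ)) ^ 3 * (1 + 3 / (p : ℝ)))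
      =O[Filter.atTop] fun X : ℝ => Real.sqrt X * Real.log X := by
  obtain ⟨B1, h1⟩ := summatory_oddTriple_div (k := 1) le_rfl
  obtain ⟨B4, h4⟩ := summatory_oddTriple_div (k := 4) (by norm_num)
  obtain ⟨B8, h8⟩ := summatory_oddTriple_div (k := 8) (by norm_num)
  obtain ⟨B16, h16⟩ := summatory_oddTriple_div (k := 16) (by norm_num)
  set P := ∏' p : Nat.Primes, (1 - 1 / (p : ℝ)) ^ 3 * (1 + 3 / (p : ℝ))
  refine Asymptotics.IsBigO.of_bound (|B1| + 3 * |B4| + 6 * |B8| + 6 * |B16| + 12) ?_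
  filter_upwards [Filter.eventually_ge_atTop (256 : ℝ)] with X hX
  have hX0 : 0 ≤ X := by linarith
  obtain ⟨Y, hY⟩ : ∃ Y, Y = √X := ⟨_, rfl⟩
  have hY16 : 16 ≤ Y := hY ▸ Real.le_sqrt_of_sq_le (by norm_num; exact hX)
  have hlog : Real.log X = 2 * Real.log Y := by
    rw [hY, Real.log_sqrt hX0]
    ring
  have hL : 1 ≤ Real.log Y := by
    rw [Real.le_log_iff_exp_le (by linarith)]
    linarith [Real.exp_one_lt_d9]
  have hS : 6 * (biquadCount X : ℝ) = {x | IsBiquadTriple x ∧ (tripleHeight x : ℝ) ≤ Y}.ncard := by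
    rw [hY]
    exact_mod_cast six_mul_biquadCount hX0
  have hN := ncard_boundedTriples (Y := Y) (by linarith)
  have hu := ncard_boundedTriples_sub_le (Y := Y) (by linarith)
  have hl : ({x | IsBiquadTriple x ∧ (tripleHeight x : ℝ) ≤ Y}.ncard : ℝ) ≤
      (boundedTriples Y).ncard := by exact_mod_cast ncard_le_ncard_boundedTriples Y
  rw [← hS] at hu hl
  rw [hN] at hu hl
  have hY0 : 0 < Y := by linarith
  have hW : 0 ≤ Y * (1 + Real.log Y) := mul_nonneg hY0.le (by linarith)
  have g1 := abs_le.1 ((h1 Y (by linarith)).trans (mul_le_mul_of_nonneg_right (le_abs_self _) hW))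
  have g4 := abs_le.1 ((h4 Y (by linarith)).trans (mul_le_mul_of_nonneg_right (le_abs_self _) hW))
  have g8 := abs_le.1 ((h8 Y (by linarith)).trans (mul_le_mul_of_nonneg_right (le_abs_self _) hW))
  have g16 := abs_le.1
    ((h16 Y (by linarith)).trans (mul_le_mul_of_nonneg_right (le_abs_self _) hW))
  rw [div_one] at g1
  rw [← hY, hlog, Real.norm_eq_abs, Real.norm_eq_abs, 
    abs_of_nonneg (mul_nonneg hY0.le (by linarith) : 0 ≤ Y * (2 * Real.log Y))]
  set C := |B1| + 3 * |B4| + 6 * |B8| + 6 * |B16|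
  have hWle : Y * (1 + Real.log Y) ≤ Y * (2 * Real.log Y) := by gcongr; linarith
  have hYle : Y ≤ Y * (2 * Real.log Y) := by nlinarith
  have hC : 0 ≤ C := by positivity
  have hCW : C * (Y * (1 + Real.log Y)) ≤ C * (Y * (2 * Real.log Y)) := by gcongr
  have hCn : 0 ≤ C * (Y * (1 + Real.log Y)) := mul_nonneg hC hW
  have hCe : C * (Y * (1 + Real.log Y)) = |B1| * (Y * (1 + Real.log Y))
    + 3 * (|B4| * (Y * (1 + Real.log Y))) + 6 * (|B8| * (Y * (1 + Real.log Y)))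
    + 6 * (|B16| * (Y * (1 + Real.log Y))) := by simp only [C]; ring
  rw [add_mul, abs_le]
  constructor
  · linarith [g1.1, g4.1, g8.1, g16.1]
  · linarith [g1.2, g4.2, g8.2, g16.2]
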